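/- arXiv:1605.00598 — 5 statements merged into one kernel-verified Lean document; each statement's English description precedes it below -/
import Mathlib

section
/- Let F be a free group on a finite set X of generators and let R ⊆ F be a symmetrized set in which every generator is a piece relative to R. If w is a cyclically reduced word and w′ is a cyclic permutation of w, then the piece lengths ‖w‖_R and ‖w′‖_R differ by at most 1. -/
/-- A word over the alphabet `α`: a list of generators with signs
(`true` = the generator, `false` = its inverse). -/
abbrev Word (α : Type*) := List (α × Bool)

/-- The formal inverse of a word. -/
def wordInv {α : Type*} (w : Word α) : Word α := FreeGroup.invRev w

/-- A word is reduced if it equals its free reduction. -/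
def Reduced {α : Type*} [DecidableEq α] (w : Word α) : Prop := FreeGroup.reduce w = w

/-- A word is cyclically reduced if it is reduced and its first letter is not
the inverse of its last letter. -/
def CyclicallyReduced {α : Type*} [DecidableEq α] (w : Word α) : Prop :=
  Reduced w ∧ ∀ a ∈ w.head?, ∀ b ∈ w.getLast?, a ≠ (b.1, !b.2)

/-- A set of words is symmetrized if all its elements are cyclically reduced and it is
closed under cyclic permutations and under taking (formal) inverses. -/
def Symmetrized {α : Type*} [DecidableEq α] (R : Set (Word α)) : Prop :=
  (∀ r ∈ R, CyclicallyReduced r) ∧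
  (∀ r ∈ R, ∀ r' : Word α, r ~r r' → r' ∈ R) ∧
  (∀ r ∈ R, wordInv r ∈ R)

/-- A nonempty word `b` is a piece relative to `R` if it is an initial segment of two
distinct elements of `R`. -/
def Piece {α : Type*} (R : Set (Word α)) (b : Word α) : Prop :=
  b ≠ [] ∧ ∃ r₁ ∈ R, ∃ r₂ ∈ R, r₁ ≠ r₂ ∧ b <+: r₁ ∧ b <+: r₂

/-- `MaxPieceFact R w bs` says that `bs` is the factorization of `w` into maximal pieces:
each factor is a piece and, unless the factor is a suffix of `w`, the factor followed by the
next letter of `w` is not a piece. -/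
inductive MaxPieceFact {α : Type*} (R : Set (Word α)) : Word α → List (Word α) → Prop where
  | nil : MaxPieceFact R [] []
  | cons {b rest : Word α} {bs : List (Word α)}
      (hb : Piece R b)
      (hmax : ∀ (x : α × Bool) (xs : Word α), rest = x :: xs → ¬ Piece R (b ++ [x]))
      (ht : MaxPieceFact R rest bs) :
      MaxPieceFact R (b ++ rest) (b :: bs)

/-- `w` has piece length `ℓ` with respect to `R`: the factorization of `w` into maximal
pieces has `ℓ` factors. -/
def HasPieceLength {α : Type*} (R : Set (Word α)) (w : Word α) (ℓ : ℕ) : Prop :=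
  ∃ bs : List (Word α), MaxPieceFact R w bs ∧ bs.length = ℓ

theorem piece_of_prefix {α : Type*} {R : Set (Word α)} {b c : Word α}
    (h : Piece R (b ++ c)) (hb : b ≠ []) : Piece R b := by
  obtain ⟨_, r₁, h₁, r₂, h₂, hne, p₁, p₂⟩ := h
  exact ⟨hb, r₁, h₁, r₂, h₂, hne, (List.prefix_append b c).trans p₁,
    (List.prefix_append b c).trans p₂⟩

theorem piece_of_suffix {α : Type*} [DecidableEq α] {R : Set (Word α)} (hsym : Symmetrized R)
    {b c : Word α} (h : Piece R (b ++ c)) (hc : c ≠ []) : Piece R c := by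
  obtain ⟨_, r₁, h₁, r₂, h₂, hne, ⟨t₁, e₁⟩, ⟨t₂, e₂⟩⟩ := h
  refine ⟨hc, c ++ t₁ ++ b, hsym.2.1 r₁ h₁ _ ?_, c ++ t₂ ++ b, hsym.2.1 r₂ h₂ _ ?_, ?_,
    ⟨t₁ ++ b, by simp⟩, ⟨t₂ ++ b, by simp⟩⟩
  · rw [← e₁, List.append_assoc]
    exact List.isRotated_append
  · rw [← e₂, List.append_assoc]
    exact List.isRotated_append
  · intro he
    apply hne
    have := List.append_cancel_right he
    have := List.append_cancel_left this
    rw [← e₁, ← e₂, this]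

/-- The greedy factorization of a suffix is no longer than any factorization into pieces. -/
theorem greedy_le {α : Type*} [DecidableEq α] {R : Set (Word α)} (hsym : Symmetrized R)
    (cs : List (Word α)) : ∀ (t w : Word α) (bs : List (Word α)), (∀ c ∈ cs, Piece R c) →
      MaxPieceFact R w bs → t ++ w = cs.flatten → bs.length ≤ cs.length := by
  induction cs with
  | nil =>
    intro t w bs _ hm he
    cases hm with
    | nil => simp
    | cons hb hmax ht =>
      simp at he
      exact absurd he.2.1 hb.1
  | cons c cs ih =>
    intro t w bs hcs hm he
    have hcs' : ∀ c ∈ cs, Piece R c := fun d hd => hcs d (by simp [hd])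
    have hc : Piece R c := hcs c (by simp)
    rw [List.flatten_cons] at he
    rcases List.append_eq_append_iff.1 he with ⟨c', h1, h2⟩ | ⟨a', h1, h2⟩
    · cases hm with
      | nil => simp
      | @cons b rest bs hb hmax ht =>
        rcases List.append_eq_append_iff.1 h2 with ⟨d, h3, h4⟩ | ⟨d, h3, h4⟩
        · cases d with
          | nil =>
            have := ih [] rest bs hcs' ht (by simpa using h4)
            simpa using this
          | cons x xs =>
            exfalso
            refine hmax x (xs ++ cs.flatten) (by simpa using h4) ?_
            subst h3
            subst h1
            have h5 : Piece R (b ++ x :: xs) := piece_of_suffix hsym hc (by simp)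
            refine piece_of_prefix (c := xs) (by simpa using h5) (by simp)
        · have := ih d rest bs hcs' ht h4.symm
          simpa using this
    · have := ih a' w bs hcs' hm h2.symm
      simp
      omega

theorem split_pieces {α : Type*} [DecidableEq α] {R : Set (Word α)} (hsym : Symmetrized R)
    (cs : List (Word α)) : ∀ (u v : Word α), (∀ c ∈ cs, Piece R c) → cs.flatten = u ++ v →
      ∃ us vs : List (Word α), (∀ c ∈ us, Piece R c) ∧ (∀ c ∈ vs, Piece R c) ∧
        us.flatten = u ∧ vs.flatten = v ∧ us.length + vs.length ≤ cs.length + 1 := by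
  induction cs with
  | nil =>
    intro u v _ he
    simp at he
    exact ⟨[], [], by simp, by simp, by simp [he.1], by simp [he.2], by simp⟩
  | cons c cs ih =>
    intro u v hcs he
    have hcs' : ∀ c ∈ cs, Piece R c := fun d hd => hcs d (by simp [hd])
    have hc : Piece R c := hcs c (by simp)
    rw [List.flatten_cons] at he
    rcases List.append_eq_append_iff.1 he with ⟨d, h1, h2⟩ | ⟨d, h1, h2⟩
    · obtain ⟨us, vs, hu, hv, eu, ev, hl⟩ := ih d v hcs' h2
      refine ⟨c :: us, vs, ?_, hv, by simp [eu, h1], ev, by simp; omega⟩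
      simpa using ⟨hc, hu⟩
    · by_cases hu : u = []
      · refine ⟨[], c :: cs, by simp, hcs, by simp [hu], ?_, by simp⟩
        subst hu
        simpa using he
      by_cases hd : d = []
      · subst hd
        refine ⟨[c], cs, by simpa using hc, hcs', by simpa using h1, by simpa using h2.symm, ?_⟩
        simp
        omega
      · subst h1
        refine ⟨[u], d :: cs, by simpa using piece_of_prefix hc hu, ?_, by simp,
          by simpa using h2.symm, ?_⟩
        · simpa using ⟨piece_of_suffix hsym hc hd, hcs'⟩
        · simp
          omega

theorem MaxPieceFact.pieces {α : Type*} {R : Set (Word α)} {w : Word α} {bs : List (Word α)}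
    (h : MaxPieceFact R w bs) : (∀ c ∈ bs, Piece R c) ∧ bs.flatten = w := by
  induction h with
  | nil => simp
  | cons hb hmax ht ih => exact ⟨by simpa using ⟨hb, ih.1⟩, by simp [ih.2]⟩

theorem rot_le {α : Type*} [DecidableEq α] {R : Set (Word α)} (hsym : Symmetrized R)
    {u v : Word α} {ℓ ℓ' : ℕ} (h : HasPieceLength R (u ++ v) ℓ)
    (h' : HasPieceLength R (v ++ u) ℓ') : ℓ' ≤ ℓ + 1 := by
  obtain ⟨bs, hb, rfl⟩ := h
  obtain ⟨bs', hb', rfl⟩ := h'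
  obtain ⟨us, vs, hu, hv, eu, ev, hl⟩ := split_pieces hsym bs u v hb.pieces.1 hb.pieces.2
  have := greedy_le hsym (vs ++ us) [] (v ++ u) bs' (by
    intro c hc
    rcases List.mem_append.1 hc with hc | hc
    · exact hv c hc
    · exact hu c hc) hb' (by simp [eu, ev])
  rw [List.length_append] at this
  omega

/-- If `R` is a symmetrized set in which every generator is a piece, and `w'` is a cyclic
permutation of the cyclically reduced word `w`, then the piece lengths of `w` and `w'`
differ by at most `1`. -/
theorem pieceLength_isRotated {α : Type*} [DecidableEq α] (R : Set (Word α))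
    (hsym : Symmetrized R)
    (hgen : ∀ x : α × Bool, Piece R [x])
    (w w' : Word α) (hw : CyclicallyReduced w) (hrot : w ~r w')
    (ℓ ℓ' : ℕ) (h : HasPieceLength R w ℓ) (h' : HasPieceLength R w' ℓ') :
    ℓ ≤ ℓ' + 1 ∧ ℓ' ≤ ℓ + 1 := by
  obtain ⟨n, hn, rfl⟩ := List.isRotated_iff_mod.1 hrot
  rw [List.rotate_eq_drop_append_take hn] at h'
  rw [← List.take_append_drop n w] at h
  exact ⟨rot_le hsym h' h, rot_le hsym h h'⟩
end

section
/- The symmetrized closure R* of the set {r_i : i ≥ 1} of relators, consisting of all cyclic permutations of the words r_i and of their inverses, satisfies the small cancellation condition C(20): no element of R* is a product of fewer than 20 pieces relative to R*. -/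
/-- The symmetrized closure of a set of (cyclically reduced) words: all cyclic
permutations of the words and of their formal inverses. -/
def symClosure {α : Type*} (S : Set (Word α)) : Set (Word α) :=
  {w | ∃ r ∈ S, w ~r r ∨ w ~r wordInv r}

/-! The 46 generators: `a₁,…,a₂₀` are `0,…,19`, `b₁,…,b₂₀` are `20,…,39`,
`c₁,c₂,c₃` are `40,41,42` and `d₁,d₂,d₃` are `43,44,45`. -/

def genA (k : Fin 20) : Fin 46 := ⟨(k : ℕ), by have := k.isLt; omega⟩
def genB (k : Fin 20) : Fin 46 := ⟨20 + (k : ℕ), by have := k.isLt; omega⟩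
def genC (k : Fin 3) : Fin 46 := ⟨40 + (k : ℕ), by have := k.isLt; omega⟩
def genD (k : Fin 3) : Fin 46 := ⟨43 + (k : ℕ), by have := k.isLt; omega⟩

/-- The word `x^n` (with sign `s`: `true` is `x^n`, `false` is `x^{-n}`). -/
def genPow (x : Fin 46) (s : Bool) (n : ℕ) : Word (Fin 46) := List.replicate n (x, s)

/-- The word `a₁^j a₂^j ⋯ a₂₀^j`. -/
def aWord (j : ℕ) : Word (Fin 46) :=
  (List.ofFn fun k : Fin 20 => genPow (genA k) true j).flatten

/-- The word `b₁^j b₂^j ⋯ b₂₀^j`. -/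
def bWord (j : ℕ) : Word (Fin 46) :=
  (List.ofFn fun k : Fin 20 => genPow (genB k) true j).flatten

/-- The word `b₂₀^{-j} b₁₉^{-j} ⋯ b₁^{-j}`. -/
def bWordRevInv (j : ℕ) : Word (Fin 46) :=
  (List.ofFn fun k : Fin 20 => genPow (genB k.rev) false j).flatten

/-- The conjugating word `c₁^i d₁^{t} c₂^i d₂^{t} c₃^i d₃^{t}`. -/
def conjWord (i ti : ℕ) : Word (Fin 46) :=
  genPow (genC 0) true i ++ genPow (genD 0) true ti ++
  genPow (genC 1) true i ++ genPow (genD 1) true ti ++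
  genPow (genC 2) true i ++ genPow (genD 2) true ti

/-- The inverse conjugating word `d₃^{-t} c₃^{-i} d₂^{-t} c₂^{-i} d₁^{-t} c₁^{-i}`. -/
def conjWordInv (i ti : ℕ) : Word (Fin 46) :=
  genPow (genD 2) false ti ++ genPow (genC 2) false i ++
  genPow (genD 1) false ti ++ genPow (genC 1) false i ++
  genPow (genD 0) false ti ++ genPow (genC 0) false i

/-- The relator
`r_i = a₁^j ⋯ a₂₀^j · c₁^i d₁^{t(i)} ⋯ c₃^i d₃^{t(i)} · b₂₀^{-j} ⋯ b₁^{-j} · d₃^{-t(i)} ⋯ c₁^{-i}`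
where `j = f i`. -/
def relatorWord (f t : ℕ → ℕ) (i : ℕ) : Word (Fin 46) :=
  aWord (f i) ++ conjWord i (t i) ++ bWordRevInv (f i) ++ conjWordInv i (t i)

/-- The set of relators `{r_i : i ≥ 1}` as elements of the free group. -/
def relatorSet (f t : ℕ → ℕ) : Set (FreeGroup (Fin 46)) :=
  {r | ∃ i : ℕ, 1 ≤ i ∧ r = FreeGroup.mk (relatorWord f t i)}

/-- The group `G`: the quotient of the free group on the 46 generators by the
normal closure of the relators `r_i`, `i ≥ 1`. -/
abbrev GroupG (f t : ℕ → ℕ) : Type :=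
  FreeGroup (Fin 46) ⧸ Subgroup.normalClosure (relatorSet f t)

/-- The quotient map `mk : F → G` (on words). -/
def mkG (f t : ℕ → ℕ) (w : Word (Fin 46)) : GroupG f t :=
  QuotientGroup.mk (FreeGroup.mk w)

abbrev Ltr := Fin 46 × Bool

theorem rot_split {α : Type*} {l l' : List α} (h : l ~r l') :
    ∃ A B, l = A ++ B ∧ l' = B ++ A := by
  obtain ⟨n, rfl⟩ := h
  refine ⟨l.take (n % l.length), l.drop (n % l.length), by simp, ?_⟩
  rw [List.rotate_eq_drop_append_take_mod]

/-- If no block starts with a letter of `m`, an infix `z :: m` of the concatenation lies in one block. -/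
theorem infix_block {α : Type*} (z : α) (m : List α) (bs : List (List α))
    (hne : ∀ b ∈ bs, b ≠ []) (hh : ∀ b ∈ bs, ∀ x ∈ m, b.head? ≠ some x) :
    ∀ u v, bs.flatten = u ++ z :: m ++ v → ∃ b ∈ bs, ∃ v', b = u ++ z :: m ++ v' ∨ ∃ u', b = u' ++ z :: m ++ v' := by
  induction bs with
  | nil => intro u v h; simp at h
  | cons b bs ih =>
    intro u v h
    have hne' : ∀ b ∈ bs, b ≠ [] := fun b hb => hne b (List.mem_cons_of_mem _ hb)
    have hh' : ∀ b ∈ bs, ∀ x ∈ m, b.head? ≠ some x := fun b hb => hh b (List.mem_cons_of_mem _ hb)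
    rw [List.flatten_cons, List.append_assoc] at h
    rcases List.append_eq_append_iff.1 h with ⟨a', h1, h2⟩ | ⟨c', h1, h2⟩
    · skip
      obtain ⟨b', hb', v', hv⟩ := ih hne' hh' a' v (by rw [h2, List.append_assoc])
      refine ⟨b', List.mem_cons_of_mem _ hb', v', Or.inr ?_⟩
      rcases hv with hv | hv
      · exact ⟨_, hv⟩
      · exact hv
    · skip
      rcases c' with _ | ⟨y, c⟩
      · obtain ⟨b', hb', v', hv⟩ := ih hne' hh' [] v (by simpa using h2.symm)
        refine ⟨b', List.mem_cons_of_mem _ hb', v', Or.inr ?_⟩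
        rcases hv with hv | hv
        · exact ⟨_, hv⟩
        · exact hv
      · simp only [List.cons_append, List.cons.injEq] at h2
        obtain ⟨rfl, h2⟩ := h2
        rcases List.append_eq_append_iff.1 h2 with ⟨a', h3, h4⟩ | ⟨d, h3, h4⟩
        · exact ⟨b, List.mem_cons_self, a', Or.inl (by rw [h1, h3]; simp)⟩
        · rcases d with _ | ⟨x, d⟩
          · exact ⟨b, List.mem_cons_self, [], Or.inl (by rw [h1, h3]; simp)⟩
          · exfalso
            rcases bs with _ | ⟨b2, bs⟩
            · simp at h4
            · have := hne' b2 List.mem_cons_self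
              rcases b2 with _ | ⟨w, b2⟩
              · exact this rfl
              · simp only [List.flatten_cons, List.cons_append, List.cons.injEq] at h4
                refine hh' (w :: b2) List.mem_cons_self x (by rw [h3]; simp) ?_
                simp [h4.1]

theorem rep_eq {α : Type*} {x : α} {T T' : List α} (hT : T.head? ≠ some x) (hT' : T'.head? ≠ some x) :
    ∀ j k, List.replicate j x ++ T = List.replicate k x ++ T' → j = k ∧ T = T' := by
  intro j
  induction j with
  | zero =>
    intro k h
    cases k with
    | zero => exact ⟨rfl, by simpa using h⟩
    | succ k => exfalso; apply hT; simp at h; rw [h]; simp [List.replicate_succ]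
  | succ j ih =>
    intro k h
    cases k with
    | zero => exfalso; apply hT'; simp at h; rw [← h]; simp [List.replicate_succ]
    | succ k =>
      simp only [List.replicate_succ, List.cons_append, List.cons.injEq, true_and] at h
      obtain ⟨h1, h2⟩ := ih k h
      exact ⟨by omega, h2⟩

theorem rep_split {α : Type*} {x : α} {n : ℕ} {A B : List α} (h : List.replicate n x = A ++ B) :
    (∃ p, A = List.replicate p x) ∧ ∃ q, B = List.replicate q x := by
  have := List.append_eq_replicate_iff.1 h.symm
  exact ⟨⟨_, this.2.1⟩, ⟨_, this.2.2⟩⟩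

/-- normal form of a word around the syllable `x^j`. -/
theorem syl_unique {α : Type*} {x y z : α} (hy : y ≠ x) (hz : z ≠ x) {j k : ℕ} (hj : 1 ≤ j)
    {u v T : List α} (hT : x ∉ T)
    (h : (u ++ z :: (List.replicate j x ++ [y]) ++ v) ~r (List.replicate k x ++ T)) :
    j = k ∧ T = y :: (v ++ (u ++ [z])) := by
  have h1 : (List.replicate j x ++ y :: (v ++ (u ++ [z]))) ~r (List.replicate k x ++ T) := by
    refine List.IsRotated.trans ?_ h
    have := @List.isRotated_append _ (List.replicate j x ++ y :: v) (u ++ [z])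
    simpa using this
  have hTh : T.head? ≠ some x := fun h => hT (List.mem_of_head? h)
  have hyh : (y :: (v ++ (u ++ [z]))).head? ≠ some x := by simpa using hy
  have key : List.replicate j x ++ y :: (v ++ (u ++ [z])) = List.replicate k x ++ T := by
    obtain ⟨A, B, hA, hB⟩ := rot_split h1
    rcases List.append_eq_append_iff.1 hB with ⟨a', h3, h4⟩ | ⟨c, h3, h4⟩
    · skip
      rcases A with _ | ⟨w, A⟩
      · rw [hA, hB]; simp
      · exfalso
        obtain ⟨j, rfl⟩ : ∃ j', j = j' + 1 := ⟨j - 1, by omega⟩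
        simp only [List.replicate_succ, List.cons_append, List.cons.injEq] at hA
        apply hT; rw [h4, hA.1]; simp
    · obtain ⟨-, q, hq⟩ := rep_split h3
      obtain ⟨p, hp⟩ := (rep_split h3).1
      rcases c with _ | ⟨w, c⟩
      · simp at h3 h4
        rcases A with _ | ⟨w, A⟩
        · rw [hA, hB]; simp
        · exfalso
          obtain ⟨j, rfl⟩ : ∃ j', j = j' + 1 := ⟨j - 1, by omega⟩
          simp only [List.replicate_succ, List.cons_append, List.cons.injEq] at hA
          apply hT; rw [← h4, hA.1]; simp
      · rcases List.eq_nil_or_concat B with rfl | ⟨B', w', rfl⟩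
        · rw [hA, hB]; simp
        · exfalso
          have e := congrArg List.getLast? hA
          have hw : w' = x := by
            have : w' ∈ List.replicate p x := by rw [← hp]; simp
            exact List.eq_of_mem_replicate this
          subst hw
          rw [show List.replicate j w' ++ y :: (v ++ (u ++ [z])) = (List.replicate j w' ++ y :: (v ++ u)) ++ [z] by simp] at e
          rw [List.concat_eq_append, ← List.append_assoc, List.getLast?_concat, List.getLast?_concat] at e
          exact hz (Option.some.inj e)
  obtain ⟨h2, h3⟩ := rep_eq hyh hTh _ _ key
  exact ⟨h2, h3.symm⟩

def expand (e : Ltr → ℕ) (M : List Ltr) : Word (Fin 46) := M.flatMap fun x => List.replicate (e x) x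

theorem mem_of_mem_expand {e : Ltr → ℕ} {M : List Ltr} {x : Ltr} (h : x ∈ expand e M) : x ∈ M := by
  simp only [expand, List.mem_flatMap] at h
  obtain ⟨a, ha, hx⟩ := h
  rw [List.eq_of_mem_replicate hx]; exact ha

theorem expand_append (e : Ltr → ℕ) (M N : List Ltr) : expand e (M ++ N) = expand e M ++ expand e N := by
  simp [expand]

theorem expand_cons (e : Ltr → ℕ) (x : Ltr) (N : List Ltr) :
    expand e (x :: N) = List.replicate (e x) x ++ expand e N := by
  simp [expand]

theorem core (M M' : List Ltr) (e : ℕ → Ltr → ℕ) (f : ℕ → ℕ) (hf : Function.Injective f)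
    (P Q : Fin 20 → Ltr) (hnd : M.Nodup) (hPQ : ∀ m, [P m, Q m] <:+: M) (hM' : ∀ m, P m ∉ M')
    (hdis : ∀ m n, m ≠ n → P m ≠ P n ∧ P m ≠ Q n ∧ Q m ≠ Q n)
    (heP : ∀ i m, e i (P m) = f i) (hf1 : ∀ i, 1 ≤ i → 1 ≤ f i) (heQ : ∀ i m, e i (Q m) = f i)
    (R : Set (Word (Fin 46)))
    (hR : ∀ w ∈ R, ∃ i, 1 ≤ i ∧ (w ~r expand (e i) M ∨ w ~r expand (e i) M'))
    (r : Word (Fin 46)) (i : ℕ) (hi : 1 ≤ i) (hr : r ~r expand (e i) M)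
    (bs : List (Word (Fin 46))) (hbs : ∀ b ∈ bs, Piece R b) (hflat : r = bs.flatten) :
    20 ≤ bs.length := by
  have claim : ∀ m, ∃ b ∈ bs, b.head? = some (P m) ∨ b.head? = some (Q m) := by
    intro m
    by_contra! hcon
    obtain ⟨L1, L2, hL⟩ := hPQ m
    have hL' : M = L1 ++ P m :: Q m :: L2 := by rw [← hL]; simp
    have hnd' := hnd
    rw [hL', List.nodup_middle] at hnd'
    simp only [List.nodup_cons, List.mem_append, List.mem_cons, not_or] at hnd'
    obtain ⟨⟨hP1, hPQne, hP2⟩, -⟩ := hnd'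
    -- normal form
    have hrot : ∀ k, expand (e k) M ~r (List.replicate (f k) (P m) ++ (List.replicate (f k) (Q m) ++ expand (e k) (L2 ++ L1))) := by
      intro k
      rw [hL', expand_append, expand_cons, expand_cons, expand_append, heP, heQ]
      have := @List.isRotated_append _ (expand (e k) L1) (List.replicate (f k) (P m) ++ (List.replicate (f k) (Q m) ++ expand (e k) L2))
      simpa using this
    have hPT : ∀ k, P m ∉ List.replicate (f k) (Q m) ++ expand (e k) (L2 ++ L1) := by
      intro k hk
      rcases List.mem_append.1 hk with hk | hk
      · exact hPQne (List.eq_of_mem_replicate hk)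
      · rcases List.mem_append.1 (mem_of_mem_expand hk) with h | h
        · exact hP2 h
        · exact hP1 h
    have hj := hf1 i hi
    obtain ⟨j, hjj⟩ : ∃ j', f i = j' + 1 := ⟨f i - 1, by omega⟩
    -- head of r
    have hhead : r.head? ≠ some (P m) ∧ r.head? ≠ some (Q m) := by
      rw [hflat]
      rcases bs with _ | ⟨b, bs⟩
      · simp
      · have := (hbs b List.mem_cons_self).1
        have h2 := hcon b List.mem_cons_self
        rcases b with _ | ⟨w, b⟩
        · exact absurd rfl this
        · simpa using h2
    -- r contains z x^j y
    have hinf : ∃ u z v, z ≠ P m ∧ r = u ++ z :: (List.replicate (f i) (P m) ++ [Q m]) ++ v := by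
      obtain ⟨A, B, hA, hB⟩ := rot_split (hr.trans (hrot i))
      rcases List.append_eq_append_iff.1 hB with ⟨a', h3, h4⟩ | ⟨c, h3, h4⟩
      · rcases List.append_eq_append_iff.1 h4 with ⟨a2, h5, h6⟩ | ⟨c2, h5, h6⟩
        · rcases List.eq_nil_or_concat A with rfl | ⟨A', z, rfl⟩
          · exfalso; apply hhead.1; rw [hA, h3, hjj]; simp [List.replicate_succ]
          · refine ⟨A', z, List.replicate j (Q m) ++ a2, ?_, ?_⟩
            · rintro rfl
              apply hPT i; rw [h6]; simp
            · rw [hA, h3, h5, hjj]; simp [List.replicate_succ]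
        · skip
          rcases c2 with _ | ⟨w, c2⟩
          · rcases List.eq_nil_or_concat A with rfl | ⟨A', z, rfl⟩
            · exfalso; apply hhead.1; rw [hA, h3, hjj]; simp [List.replicate_succ]
            · refine ⟨A', z, List.replicate j (Q m), ?_, ?_⟩
              · rintro rfl
                apply hPT i; rw [List.mem_append]; right
                simp only [List.nil_append] at h6
                rw [← h6]; simp
              · simp only [List.append_nil] at h5
                rw [hA, h3, ← h5, hjj]; simp [List.replicate_succ]
          · exfalso; apply hhead.2
            have : w = Q m := List.eq_of_mem_replicate (n := f i) (by rw [h5]; simp)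
            rw [hA, h6, this]; simp
      · exfalso
        rcases c with _ | ⟨w, c⟩
        · apply hhead.2; rw [hA, h4, hjj]; simp [List.replicate_succ]
        · apply hhead.1
          have : w = P m := List.eq_of_mem_replicate (n := f i) (by rw [h3]; simp)
          rw [hA, h4, this]; simp
    obtain ⟨u, z, v, hz, hruv⟩ := hinf
    have hblk := infix_block z (List.replicate (f i) (P m) ++ [Q m]) bs (fun b hb => (hbs b hb).1)
      (by
        intro b hb x hx
        rcases List.mem_append.1 hx with hx | hx
        · rw [List.eq_of_mem_replicate hx]; exact (hcon b hb).1
        · rw [List.mem_singleton.1 hx]; exact (hcon b hb).2) u v (by rw [← hflat, hruv])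
    obtain ⟨b, hb, u', v', hbv⟩ : ∃ b ∈ bs, ∃ u' v', b = u' ++ z :: (List.replicate (f i) (P m) ++ [Q m]) ++ v' := by
      obtain ⟨b, hb, v', h | ⟨u', h⟩⟩ := hblk
      · exact ⟨b, hb, _, _, h⟩
      · exact ⟨b, hb, _, _, h⟩
    obtain ⟨-, r1, hr1, r2, hr2, hne, ⟨s1, hp1⟩, ⟨s2, hp2⟩⟩ := hbs b hb
    have key : ∀ w ∈ R, ∀ s, b ++ s = w → ∃ k, f i = f k ∧
        List.replicate (f k) (Q m) ++ expand (e k) (L2 ++ L1) = Q m :: ((v' ++ s) ++ (u' ++ [z])) := by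
      intro w hw s hs
      have hw2 : w = u' ++ z :: (List.replicate (f i) (P m) ++ [Q m]) ++ (v' ++ s) := by
        rw [← hs, hbv]; simp
      have hPw : P m ∈ w := by rw [hw2, hjj]; simp
      obtain ⟨k, hk, hwk | hwk⟩ := hR w hw
      · have := hwk.trans (hrot k)
        rw [hw2] at this
        exact ⟨k, syl_unique (Ne.symm hPQne) hz hj (hPT k) this⟩
      · exact absurd (mem_of_mem_expand (hwk.mem_iff.1 hPw)) (hM' m)
    obtain ⟨k1, hk1, e1⟩ := key r1 hr1 s1 hp1
    obtain ⟨k2, hk2, e2⟩ := key r2 hr2 s2 hp2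
    have hk : k1 = k2 := hf (hk1.symm.trans hk2)
    subst hk
    rw [e1] at e2
    simp only [List.cons.injEq, true_and, List.append_assoc, List.append_cancel_left_eq] at e2
    have : s1 = s2 := List.append_cancel_right e2
    apply hne; rw [← hp1, ← hp2, this]
  choose g hg hg2 using claim
  have hinj : Function.Injective g := by
    intro m n hmn
    by_contra hne
    obtain ⟨d1, d2, d3⟩ := hdis m n hne
    obtain ⟨-, d4, -⟩ := hdis n m (Ne.symm hne)
    have h1 := hg2 m
    have h2 := hg2 n
    rw [hmn] at h1
    rcases h1 with h1 | h1 <;> rcases h2 with h2 | h2 <;> rw [h1] at h2 <;>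
      simp only [Option.some.injEq] at h2
    · exact d1 h2
    · exact d2 h2
    · exact d4 h2.symm
    · exact d3 h2
  have h1 : (Finset.univ.image g).card = 20 := by
    rw [Finset.card_image_of_injective _ hinj]; simp
  have h2 : Finset.univ.image g ⊆ bs.toFinset := by
    intro b hb
    obtain ⟨m, -, rfl⟩ := Finset.mem_image.1 hb
    exact List.mem_toFinset.2 (hg m)
  rw [← h1]
  exact (Finset.card_le_card h2).trans (List.toFinset_card_le bs)

def baseL : List Ltr :=
  (List.ofFn fun k : Fin 20 => (genA k, true)) ++
  [(genC 0, true), (genD 0, true), (genC 1, true), (genD 1, true), (genC 2, true), (genD 2, true)] ++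
  (List.ofFn fun k : Fin 20 => (genB k.rev, false)) ++
  [(genD 2, false), (genC 2, false), (genD 1, false), (genC 1, false), (genD 0, false), (genC 0, false)]

def baseL' : List Ltr := (baseL.map fun x => (x.1, !x.2)).reverse

def expo (f t : ℕ → ℕ) (i : ℕ) (x : Ltr) : ℕ :=
  if x.1.1 < 40 then f i else if x.1.1 < 43 then i else t i

theorem relator_expand (f t : ℕ → ℕ) (i : ℕ) : relatorWord f t i = expand (expo f t i) baseL := by
  have hA : ∀ k : Fin 20, expo f t i (genA k, true) = f i := by
    intro k
    have := k.isLt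
    have hv : (genA k).1 = (k : ℕ) := rfl
    unfold expo
    rw [if_pos (by dsimp only; omega)]
  have hB : ∀ k : Fin 20, expo f t i (genB k, false) = f i := by
    intro k
    have := k.isLt
    have hv : (genB k).1 = 20 + (k : ℕ) := rfl
    unfold expo
    rw [if_pos (by dsimp only; omega)]
  have hC : ∀ (k : Fin 3) s, expo f t i (genC k, s) = i := by
    intro k s
    have := k.isLt
    have hv : (genC k).1 = 40 + (k : ℕ) := rfl
    unfold expo
    rw [if_neg (by dsimp only; omega), if_pos (by dsimp only; omega)]
  have hD : ∀ (k : Fin 3) s, expo f t i (genD k, s) = t i := by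
    intro k s
    have := k.isLt
    have hv : (genD k).1 = 43 + (k : ℕ) := rfl
    unfold expo
    rw [if_neg (by dsimp only; omega), if_neg (by dsimp only; omega)]
  have e1 : aWord (f i) = expand (expo f t i) (List.ofFn fun k : Fin 20 => (genA k, true)) := by
    simp only [aWord, expand, List.flatMap, List.map_ofFn, genPow]
    congr 2; funext k; simp [hA]
  have e2 : bWordRevInv (f i) = expand (expo f t i) (List.ofFn fun k : Fin 20 => (genB k.rev, false)) := by
    simp only [bWordRevInv, expand, List.flatMap, List.map_ofFn, genPow]
    congr 2; funext k; simp [hB]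
  rw [relatorWord, e1, e2, baseL, expand_append, expand_append, expand_append]
  simp only [conjWord, conjWordInv, genPow, expand_cons, hC, hD, List.append_assoc]
  simp [expand]

theorem inv_expand (f t : ℕ → ℕ) (i : ℕ) (M : List Ltr) :
    wordInv (expand (expo f t i) M) = expand (expo f t i) (M.map fun x => (x.1, !x.2)).reverse := by
  induction M with
  | nil => simp [expand, wordInv, FreeGroup.invRev]
  | cons x M ih =>
    rw [expand_cons, List.map_cons, List.reverse_cons, expand_append, ← ih, expand_cons]
    simp [wordInv, FreeGroup.invRev, expand, expo]

/-- The symmetrized closure of the set `{r_i : i ≥ 1}` of relators satisfies the small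
cancellation condition `C(20)`: no element of it is a product of fewer than `20` pieces. -/
theorem relators_C20 (f t : ℕ → ℕ) (hf : Function.Injective f)
    (hf1 : ∀ i : ℕ, 1 ≤ i → 1 ≤ f i) (ht1 : ∀ i : ℕ, 1 ≤ i → 1 ≤ t i) :
    ∀ r ∈ symClosure {w | ∃ i : ℕ, 1 ≤ i ∧ w = relatorWord f t i},
      ∀ bs : List (Word (Fin 46)),
        (∀ b ∈ bs, Piece (symClosure {w | ∃ i : ℕ, 1 ≤ i ∧ w = relatorWord f t i}) b) →
        r = bs.flatten → 20 ≤ bs.length := by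
  have hR : ∀ w ∈ symClosure {w | ∃ i : ℕ, 1 ≤ i ∧ w = relatorWord f t i},
      ∃ i, 1 ≤ i ∧ (w ~r expand (expo f t i) baseL ∨ w ~r expand (expo f t i) baseL') := by
    rintro w ⟨_, ⟨i, hi, rfl⟩, h⟩
    refine ⟨i, hi, ?_⟩
    rw [relator_expand, inv_expand] at h
    exact h
  intro r hr bs hbs hflat
  have hex : ∀ i (x : Ltr), x.1.1 < 40 → expo f t i x = f i := by
    intro i x hx; simp [expo, hx]
  obtain ⟨i, hi, h | h⟩ := hR r hr
  · refine core baseL baseL' (expo f t) f hf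
      (fun m => baseL.getD (if m.1 < 10 then 2 * m.1 else 6 + 2 * m.1) (0, true))
      (fun m => baseL.getD (if m.1 < 10 then 2 * m.1 + 1 else 7 + 2 * m.1) (0, true))
      ?_ ?_ ?_ ?_ (fun i m => hex i _ ?_) hf1 (fun i m => hex i _ ?_) _ hR r i hi h bs hbs hflat
    · decide +kernel
    · decide +kernel
    · decide +kernel
    · decide +kernel
    · revert m; decide +kernel
    · revert m; decide +kernel
  · refine core baseL' baseL (expo f t) f hf
      (fun m => baseL'.getD (if m.1 < 10 then 6 + 2 * m.1 else 12 + 2 * m.1) (0, true))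
      (fun m => baseL'.getD (if m.1 < 10 then 7 + 2 * m.1 else 13 + 2 * m.1) (0, true))
      ?_ ?_ ?_ ?_ (fun i m => hex i _ ?_) hf1 (fun i m => hex i _ ?_) _
      (fun w hw => (hR w hw).imp fun k hk => ⟨hk.1, hk.2.symm⟩) r i hi h bs hbs hflat
    · decide +kernel
    · decide +kernel
    · decide +kernel
    · decide +kernel
    · revert m; decide +kernel
    · revert m; decide +kernel
end

section
/- For every integer j ≥ 1, the elements α_j = mk(a₁^j ⋯ a₂₀^j) and β_j = mk(b₁^j ⋯ b₂₀^j) are conjugate in G if and only if j ∈ A, where A = {f(i) : i ≥ 1}. -/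
/-! ### Easy direction -/

theorem inv_bWord (n : ℕ) :
    (FreeGroup.mk (bWord n))⁻¹ = FreeGroup.mk (bWordRevInv n) := by
  rw [FreeGroup.inv_mk]
  congr 1
  simp [FreeGroup.invRev, bWord, bWordRevInv, genPow, List.ofFn_succ, genB, Fin.rev]

theorem inv_conjWord (n s : ℕ) :
    (FreeGroup.mk (conjWord n s))⁻¹ = FreeGroup.mk (conjWordInv n s) := by
  rw [FreeGroup.inv_mk]
  congr 1
  simp [FreeGroup.invRev, conjWord, conjWordInv, genPow]

/-! ### A permutation representation separating `α_j` from the other `α_m` -/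

/-- Shift of the first coordinate. -/
def permX (k : ℤ) : Equiv.Perm (ℤ × ℤ × ℤ) where
  toFun p := (p.1 + k, p.2.1, p.2.2)
  invFun p := (p.1 - k, p.2.1, p.2.2)
  left_inv p := by simp
  right_inv p := by simp

/-- Translation of the second coordinate over the fibre `0`. -/
def permY (k : ℤ) : Equiv.Perm (ℤ × ℤ × ℤ) where
  toFun p := (p.1, p.2.1 + (if p.1 = 0 then k else 0), p.2.2)
  invFun p := (p.1, p.2.1 - (if p.1 = 0 then k else 0), p.2.2)
  left_inv p := by simp
  right_inv p := by simp

/-- Shear over the fibre `j`. -/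
def permZ (j : ℤ) (k : ℤ) : Equiv.Perm (ℤ × ℤ × ℤ) where
  toFun p := (p.1, p.2.1, p.2.2 + (if p.1 = j then k * p.2.1 else 0))
  invFun p := (p.1, p.2.1, p.2.2 - (if p.1 = j then k * p.2.1 else 0))
  left_inv p := by simp
  right_inv p := by simp

theorem permX_pow (n : ℕ) : permX 1 ^ n = permX n := by
  induction n with
  | zero => ext p <;> simp [permX]
  | succ n ih => rw [pow_succ, ih]; ext p <;> simp [permX] <;> ring

theorem permY_pow (n : ℕ) : permY 1 ^ n = permY n := by
  induction n with
  | zero => ext p <;> simp [permY]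
  | succ n ih => rw [pow_succ, ih]; ext p <;> simp [permY]; split_ifs <;> ring

theorem permZ_pow (j : ℤ) (n : ℕ) : permZ j 1 ^ n = permZ j n := by
  induction n with
  | zero => ext p <;> simp [permZ]
  | succ n ih => rw [pow_succ, ih]; ext p <;> simp [permZ]; split_ifs <;> ring

/-- The images of the generators. -/
def genImage (j : ℤ) (g : Fin 46) : Equiv.Perm (ℤ × ℤ × ℤ) :=
  match (g : ℕ) with
  | 0 => permX 1
  | 1 => permY 1
  | 2 => (permX 1)⁻¹
  | 3 => permZ j 1
  | 4 => permX 1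
  | 5 => (permY 1)⁻¹
  | 6 => (permX 1)⁻¹
  | 7 => (permZ j 1)⁻¹
  | _ => 1

theorem genImage_eq_one (j : ℤ) (g : Fin 46) (h : 8 ≤ (g : ℕ)) : genImage j g = 1 := by
  unfold genImage
  split <;> first | omega | rfl

/-- The representation of the free group. -/
def repHom (j : ℤ) : FreeGroup (Fin 46) →* Equiv.Perm (ℤ × ℤ × ℤ) :=
  FreeGroup.lift (genImage j)

theorem repHom_append (j : ℤ) (u v : Word (Fin 46)) :
    repHom j (FreeGroup.mk (u ++ v)) = repHom j (FreeGroup.mk u) * repHom j (FreeGroup.mk v) := by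
  rw [← FreeGroup.mul_mk, map_mul]

theorem repHom_genPow (j : ℤ) (g : Fin 46) (n : ℕ) :
    repHom j (FreeGroup.mk (genPow g true n)) = genImage j g ^ n := by
  simp [repHom, genPow, FreeGroup.lift_mk]

theorem repHom_triv (j : ℤ) (w : Word (Fin 46)) (h : ∀ l ∈ w, 8 ≤ (l.1 : ℕ)) :
    repHom j (FreeGroup.mk w) = 1 := by
  rw [repHom, FreeGroup.lift_mk]
  apply List.prod_eq_one
  intro x hx
  obtain ⟨l, hl, rfl⟩ := List.mem_map.1 hx
  rw [genImage_eq_one j l.1 (h l hl)]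
  cases l.2 <;> simp

theorem repHom_aWord (j : ℤ) (m : ℕ) :
    repHom j (FreeGroup.mk (aWord m)) =
      permX m * permY m * (permX m)⁻¹ * permZ j m * permX m * (permY m)⁻¹ * (permX m)⁻¹ *
        (permZ j m)⁻¹ := by
  have h0 : repHom j (FreeGroup.mk []) = 1 := repHom_triv j [] (by simp)
  simp only [aWord, List.ofFn_succ, List.ofFn_zero, List.flatten_cons, List.flatten_nil,
    repHom_append, repHom_genPow, h0]
  simp [genA, genImage, permX_pow, permY_pow, permZ_pow, mul_assoc]

theorem repHom_aWord_ne (j : ℤ) (m : ℕ) (h : (m : ℤ) ≠ j) :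
    repHom j (FreeGroup.mk (aWord m)) = 1 := by
  rw [repHom_aWord, mul_inv_eq_one]
  ext p
  all_goals
    simp only [Equiv.Perm.mul_apply, Equiv.Perm.inv_def, permX, permY, permZ, Equiv.coe_fn_mk,
      Equiv.coe_fn_symm_mk, Equiv.Perm.one_apply]
    (repeat' split_ifs) <;> first | omega | grind

theorem repHom_aWord_eq (m : ℕ) (h : 1 ≤ m) :
    repHom m (FreeGroup.mk (aWord m)) ≠ 1 := by
  rw [repHom_aWord]
  intro H
  rw [mul_inv_eq_one] at H
  have := congrArg (fun e : Equiv.Perm (ℤ × ℤ × ℤ) => (e ((m : ℤ), 0, 0)).2.2) H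
  simp [Equiv.Perm.inv_def, permX, permY, permZ] at this
  omega

theorem repHom_bWord (j : ℤ) (m : ℕ) : repHom j (FreeGroup.mk (bWord m)) = 1 := by
  apply repHom_triv
  intro l hl
  simp only [bWord, List.mem_flatten, List.mem_ofFn] at hl
  obtain ⟨_, ⟨k, rfl⟩, hl⟩ := hl
  rw [genPow, List.mem_replicate] at hl
  rw [hl.2]
  simp only [genB]
  omega

theorem repHom_conjWord (j : ℤ) (n s : ℕ) : repHom j (FreeGroup.mk (conjWord n s)) = 1 := by
  apply repHom_triv
  intro l hl
  simp only [conjWord, genPow, List.mem_append, List.mem_replicate] at hl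
  rcases hl with ((((hl | hl) | hl) | hl) | hl) | hl <;> rw [hl.2] <;> simp [genC, genD]

theorem repHom_relator (f t : ℕ → ℕ) (j : ℤ) (i : ℕ) (h : (f i : ℤ) ≠ j) :
    repHom j (FreeGroup.mk (relatorWord f t i)) = 1 := by
  simp only [relatorWord, repHom_append, ← inv_bWord, ← inv_conjWord, map_inv, repHom_bWord,
    repHom_conjWord, repHom_aWord_ne j (f i) h, inv_one, mul_one]

/-- For every `j ≥ 1`, the images of `a₁^j ⋯ a₂₀^j` and `b₁^j ⋯ b₂₀^j` are conjugate in `G`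
if and only if `j ∈ A = {f(i) : i ≥ 1}`. -/
theorem conj_iff_mem_A (f t : ℕ → ℕ) (hf : Function.Injective f)
    (hf1 : ∀ i : ℕ, 1 ≤ i → 1 ≤ f i) (ht1 : ∀ i : ℕ, 1 ≤ i → 1 ≤ t i)
    (j : ℕ) (hj : 1 ≤ j) :
    IsConj (mkG f t (aWord j)) (mkG f t (bWord j)) ↔ ∃ i : ℕ, 1 ≤ i ∧ f i = j := by
  constructor
  · intro h
    by_contra hne
    have hle : Subgroup.normalClosure (relatorSet f t) ≤ (repHom (j : ℤ)).ker := by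
      apply Subgroup.normalClosure_le_normal
      rintro _ ⟨i, hi, rfl⟩
      refine repHom_relator f t j i ?_
      intro he
      exact hne ⟨i, hi, by exact_mod_cast he⟩
    have h2 := (QuotientGroup.lift _ (repHom (j : ℤ)) hle).map_isConj h
    have ha : (QuotientGroup.lift _ (repHom (j : ℤ)) hle) (mkG f t (aWord j)) =
      repHom (j : ℤ) (FreeGroup.mk (aWord j)) := rfl
    have hb : (QuotientGroup.lift _ (repHom (j : ℤ)) hle) (mkG f t (bWord j)) =
      repHom (j : ℤ) (FreeGroup.mk (bWord j)) := rfl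
    rw [ha, hb, repHom_bWord, isConj_one_left] at h2
    exact repHom_aWord_eq j hj h2
  · rintro ⟨i, hi, rfl⟩
    have hr : (QuotientGroup.mk (FreeGroup.mk (relatorWord f t i)) : GroupG f t) = 1 :=
      (QuotientGroup.eq_one_iff _).2 (Subgroup.subset_normalClosure ⟨i, hi, rfl⟩)
    simp only [relatorWord, ← FreeGroup.mul_mk, ← inv_bWord, ← inv_conjWord,
      QuotientGroup.mk_mul, QuotientGroup.mk_inv] at hr
    rw [isConj_comm, isConj_iff]
    refine ⟨QuotientGroup.mk (FreeGroup.mk (conjWord i (t i))), ?_⟩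
    unfold mkG
    rw [mul_inv_eq_one, mul_inv_eq_iff_eq_mul] at hr
    rw [mul_inv_eq_iff_eq_mul, hr]
end

section
/- Suppose in addition that f and t are computable. Then there is a computable function ρ : F → F such that for every word w ∈ F, the word ρ(w) is weakly cyclically R*-reduced (where R* is the symmetrized closure of {r_i : i ≥ 1}) and mk(ρ(w)) is conjugate to mk(w) in G. -/
/-- A word is a power of a single generator. -/
def IsGenPower {α : Type*} (w : Word α) : Prop :=
  ∃ (x : α × Bool) (n : ℕ), w = List.replicate n x

/-- `w` contains an element of `R` with at most `k` pieces missing: `w ≡ u s v` and there is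
`r ∈ R` with `r ≡ s t` where the piece length of `t` is at most `k`. -/
def ContainsAlmostRelator {α : Type*} (R : Set (Word α)) (k : ℕ) (w : Word α) : Prop :=
  ∃ u s v : Word α, w = u ++ s ++ v ∧
    ∃ r ∈ R, ∃ tl : Word α, r = s ++ tl ∧ ∃ ℓ ≤ k, HasPieceLength R tl ℓ

/-- `w` is weakly cyclically `R`-reduced: `w` is cyclically reduced, `w` does not begin and
end with powers of the same generator unless it is a power of a single generator, and no
cyclic permutation of `w` contains an element of `R` with at most `7` pieces missing. -/
def WeaklyCyclicallyReduced {α : Type*} [DecidableEq α] (R : Set (Word α)) (w : Word α) : Prop :=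
  CyclicallyReduced w ∧
  (IsGenPower w ∨ ∀ a ∈ w.head?, ∀ b ∈ w.getLast?, a.1 ≠ b.1) ∧
  ∀ w' : Word α, w ~r w' → ¬ ContainsAlmostRelator R 7 w'

namespace WCR

/-! ### The algorithm and its computability -/

abbrev Ltr := Fin 46 × Bool

/-- All rotations of a list. -/
def rots (l : Word (Fin 46)) : List (Word (Fin 46)) :=
  (List.range (l.length + 1)).map fun n => l.drop n ++ l.take n

def lC : List (Ltr × Fin 3) :=
  [((40, true), 1), ((43, true), 2), ((41, true), 1), ((44, true), 2), ((42, true), 1),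
   ((45, true), 2)]

def lC' : List (Ltr × Fin 3) :=
  [((45, false), 2), ((42, false), 1), ((44, false), 2), ((41, false), 1), ((43, false), 2),
   ((40, false), 1)]

def lA : Bool → List (Ltr × Fin 3)
  | true => (List.finRange 20).map fun k => ((genA k, true), 0)
  | false => (List.finRange 20).map fun k => ((genA k.rev, false), 0)

def lB : Bool → List (Ltr × Fin 3)
  | true => (List.finRange 20).map fun k => ((genB k.rev, false), 0)
  | false => (List.finRange 20).map fun k => ((genB k, true), 0)

def spec (o : Bool) : List (Ltr × Fin 3) := lA o ++ lC ++ lB o ++ lC'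

def ev (e : ℕ × ℕ × ℕ) (k : Fin 3) : ℕ := if k = 0 then e.1 else if k = 1 then e.2.1 else e.2.2

def ex (L : List (Ltr × Fin 3)) (e : ℕ × ℕ × ℕ) : Word (Fin 46) :=
  L.flatMap fun p => List.replicate (ev e p.2) p.1

def triv : List (Word (Fin 46)) :=
  (List.finRange 46).flatMap fun x => [[(x, true), (x, false)], [(x, false), (x, true)]]

def rels (T : List (ℕ × ℕ × ℕ)) : List (Word (Fin 46)) :=
  triv ++ T.flatMap fun e => rots (ex (spec true) e) ++ rots (ex (spec false) e)

def cand (w r : Word (Fin 46)) (m : ℕ) : Word (Fin 46) :=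
  if w.take m = r.take m then wordInv (r.drop m) ++ w.drop m else w

def moves (T : List (ℕ × ℕ × ℕ)) (w : Word (Fin 46)) : List (Word (Fin 46)) :=
  (rots w).flatMap fun w' => (rels T).flatMap fun r =>
    (List.range (r.length + 1)).map fun m => cand w' r m

def pick (L : List (Word (Fin 46))) (p : Word (Fin 46) → Bool) (w : Word (Fin 46)) :
    Word (Fin 46) := (L[L.findIdx p]?).getD w

def step (T : List (ℕ × ℕ × ℕ)) (w : Word (Fin 46)) : Word (Fin 46) :=
  pick (moves T w) (fun c => decide (c.length < w.length)) w

def run (T : List (ℕ × ℕ × ℕ)) (w : Word (Fin 46)) : Word (Fin 46) := (step T)^[w.length] w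

def fin (w : Word (Fin 46)) : Word (Fin 46) :=
  pick (rots w) (fun c => !decide (c.head?.map Prod.fst = c.reverse.head?.map Prod.fst)) w

def tab (f t : ℕ → ℕ) (n : ℕ) : List (ℕ × ℕ × ℕ) :=
  (List.range n).map fun i => (f (i + 1), i + 1, t (i + 1))

def rho (f t : ℕ → ℕ) (w : Word (Fin 46)) : Word (Fin 46) :=
  fin (run (tab f t (2 * w.length + 1)) w)

section
open Primrec

theorem prim_rots : Primrec rots := by
  unfold rots
  refine list_map (list_range.comp (succ.comp list_length)) ?_
  exact list_append.comp (list_drop.comp snd fst) (list_take.comp snd fst)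

theorem prim_replicate {α : Type*} [Primcodable α] :
    Primrec₂ (fun (n : ℕ) (a : α) => List.replicate n a) := by
  refine (list_map (list_range.comp fst) (g := fun p _ => p.2) (snd.comp fst).to₂).of_eq ?_
  rintro ⟨n, a⟩
  simp

theorem prim_ev : Primrec₂ ev := by
  unfold ev
  refine ite (Primrec.eq.comp snd (const 0)) (fst.comp fst)
    (ite (Primrec.eq.comp snd (const 1)) (fst.comp (snd.comp fst)) (snd.comp (snd.comp fst)))

theorem prim_ex (L : List (Ltr × Fin 3)) : Primrec (ex L) := by
  unfold ex
  refine list_flatMap (const L) ?_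
  exact prim_replicate.comp (prim_ev.comp fst (snd.comp snd)) (fst.comp snd)

theorem prim_rels : Primrec rels := by
  unfold rels
  refine list_append.comp (const _) (list_flatMap .id ?_)
  exact (list_append.comp (prim_rots.comp ((prim_ex _).comp snd))
    (prim_rots.comp ((prim_ex _).comp snd)))

theorem prim_inv : Primrec (wordInv (α := Fin 46)) := by
  have : Primrec (fun w : Word (Fin 46) => (w.map (fun g : Ltr => (g.1, !g.2))).reverse) := by
    refine list_reverse.comp (list_map .id ?_)
    exact Primrec.pair (fst.comp snd) (Primrec.not.comp (snd.comp snd))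
  exact this

theorem prim_cand : Primrec (fun x : (Word (Fin 46) × Word (Fin 46)) × ℕ =>
    cand x.1.1 x.1.2 x.2) := by
  unfold cand
  refine ite (Primrec.eq.comp (list_take.comp snd (fst.comp fst))
    (list_take.comp snd (snd.comp fst))) ?_ (fst.comp fst)
  exact list_append.comp (prim_inv.comp (list_drop.comp snd (snd.comp fst)))
    (list_drop.comp snd (fst.comp fst))

theorem prim_moves : Primrec₂ moves := by
  unfold moves
  refine list_flatMap (prim_rots.comp snd) (list_flatMap (prim_rels.comp (fst.comp fst))
    (list_map (g := fun x m => cand x.1.2 x.2 m)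
      (list_range.comp (succ.comp (list_length.comp snd))) ?_).to₂).to₂
  exact prim_cand.comp (Primrec.pair (Primrec.pair (snd.comp (fst.comp fst))
    (snd.comp fst)) snd)

theorem prim_pick {α : Type*} [Primcodable α] {L : α → List (Word (Fin 46))}
    {p : α → Word (Fin 46) → Bool} {w : α → Word (Fin 46)} (hL : Primrec L) (hp : Primrec₂ p)
    (hw : Primrec w) : Primrec (fun a => pick (L a) (p a) (w a)) := by
  unfold pick
  exact option_getD.comp (list_getElem?.comp hL (list_findIdx hL hp)) hw

theorem prim_step : Primrec₂ step := by
  unfold step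
  refine prim_pick prim_moves ?_ snd
  exact (PrimrecRel.comp nat_lt (list_length.comp snd)
    (list_length.comp (snd.comp fst))).decide

theorem prim_run : Primrec₂ run := by
  unfold run
  exact nat_iterate (list_length.comp snd) snd (prim_step.comp (fst.comp fst) snd).to₂

theorem prim_fin : Primrec fin := by
  unfold fin
  refine prim_pick prim_rots ?_ .id
  refine Primrec.not.comp (PrimrecRel.comp Primrec.eq ?_ ?_).decide
  · exact (option_map₁ fst).comp (list_head?.comp snd)
  · exact (option_map₁ fst).comp (list_head?.comp (list_reverse.comp snd))

theorem comp_tab {f t : ℕ → ℕ} (hf : Computable f) (ht : Computable t) :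
    Computable (tab f t) := by
  have h : Computable (fun n : ℕ => Nat.rec (motive := fun _ => List (ℕ × ℕ × ℕ)) []
      (fun i l => l ++ [(f (i + 1), i + 1, t (i + 1))]) n) := by
    refine Computable.nat_rec (h := fun _ p => p.2 ++ [(f (p.1 + 1), p.1 + 1, t (p.1 + 1))])
      .id (.const []) ?_
    have hs : Computable (fun p : ℕ × ℕ × List (ℕ × ℕ × ℕ) => p.2.1 + 1) :=
      Computable.succ.comp (Computable.fst.comp Computable.snd)
    exact Computable.list_concat.comp (Computable.snd.comp Computable.snd)
      ((hf.comp hs).pair (hs.pair (ht.comp hs)))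
  refine h.of_eq fun n => ?_
  induction n with
  | zero => rfl
  | succ n ih => simp only [tab, List.range_succ, List.map_append] at ih ⊢; rw [ih]; rfl

theorem comp_rho {f t : ℕ → ℕ} (hf : Computable f) (ht : Computable t) :
    Computable (rho f t) := by
  unfold rho
  have h1 : Primrec (fun w : Word (Fin 46) => 2 * w.length + 1) :=
    succ.comp (nat_mul.comp (const 2) list_length)
  exact prim_fin.to_comp.comp
    (prim_run.to_comp.comp ((comp_tab hf ht).comp h1.to_comp) Computable.id)

end

/-! ### Relators as expansions -/

theorem ex_append (L M : List (Ltr × Fin 3)) (e : ℕ × ℕ × ℕ) :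
    ex (L ++ M) e = ex L e ++ ex M e := by simp [ex]

theorem ex_cons (p : Ltr × Fin 3) (M : List (Ltr × Fin 3)) (e : ℕ × ℕ × ℕ) :
    ex (p :: M) e = List.replicate (ev e p.2) p.1 ++ ex M e := by simp [ex]

theorem ex_nil (e : ℕ × ℕ × ℕ) : ex [] e = [] := rfl

theorem wordInv_append (u v : Word (Fin 46)) : wordInv (u ++ v) = wordInv v ++ wordInv u := by
  simp [wordInv, FreeGroup.invRev]

theorem ex_inv (L : List (Ltr × Fin 3)) (e : ℕ × ℕ × ℕ) :
    wordInv (ex L e) = ex ((L.map fun p => ((p.1.1, !p.1.2), p.2)).reverse) e := by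
  induction L with
  | nil => rfl
  | cons p L ih =>
    rw [ex_cons, wordInv_append, ih, List.map_cons, List.reverse_cons, ex_append]
    congr 1
    simp [wordInv, FreeGroup.invRev, ex]

theorem aWord_eq (e : ℕ × ℕ × ℕ) : aWord e.1 = ex (lA true) e := by
  simp only [aWord, ex, lA, List.ofFn_eq_map, List.flatMap_def, List.map_map]
  rfl

theorem bWordRevInv_eq (e : ℕ × ℕ × ℕ) : bWordRevInv e.1 = ex (lB true) e := by
  simp only [bWordRevInv, ex, lB, List.ofFn_eq_map, List.flatMap_def, List.map_map]
  rfl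

theorem conjWord_eq (e : ℕ × ℕ × ℕ) : conjWord e.2.1 e.2.2 = ex lC e := by
  simp [conjWord, ex, lC, ev, genPow, genC, genD]

theorem conjWordInv_eq (e : ℕ × ℕ × ℕ) : conjWordInv e.2.1 e.2.2 = ex lC' e := by
  simp [conjWordInv, ex, lC', ev, genPow, genC, genD]

theorem relatorWord_eq (f t : ℕ → ℕ) (i : ℕ) :
    relatorWord f t i = ex (spec true) (f i, i, t i) := by
  have h1 := aWord_eq (f i, i, t i)
  have h2 := bWordRevInv_eq (f i, i, t i)
  have h3 := conjWord_eq (f i, i, t i)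
  have h4 := conjWordInv_eq (f i, i, t i)
  simp only at h1 h2 h3 h4
  rw [relatorWord, spec, ex_append, ex_append, ex_append, h1, h2, h3, h4]

theorem relatorWord_inv (f t : ℕ → ℕ) (i : ℕ) :
    wordInv (relatorWord f t i) ~r ex (spec false) (f i, i, t i) := by
  rw [relatorWord_eq, ex_inv]
  have : ((spec true).map fun p : Ltr × Fin 3 => ((p.1.1, !p.1.2), p.2)).reverse
      = (lC ++ lB false ++ lC') ++ lA false := by decide +kernel
  have h2 : spec false = lA false ++ (lC ++ lB false ++ lC') := by simp [spec]
  rw [this, h2, ex_append _ (lA false), ex_append (lA false)]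
  exact List.isRotated_append

/-- The symmetrized set of relators. -/
abbrev RS (f t : ℕ → ℕ) : Set (Word (Fin 46)) :=
  symClosure {w | ∃ i : ℕ, 1 ≤ i ∧ w = relatorWord f t i}

theorem mem_RS {f t : ℕ → ℕ} {r : Word (Fin 46)} :
    r ∈ RS f t ↔ ∃ i, 1 ≤ i ∧ ∃ o, r ~r ex (spec o) (f i, i, t i) := by
  constructor
  · rintro ⟨_, ⟨i, hi, rfl⟩, h | h⟩
    · exact ⟨i, hi, true, relatorWord_eq f t i ▸ h⟩
    · exact ⟨i, hi, false, h.trans (relatorWord_inv f t i)⟩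
  · rintro ⟨i, hi, o, h⟩
    refine ⟨_, ⟨i, hi, rfl⟩, ?_⟩
    cases o
    · exact Or.inr (h.trans (relatorWord_inv f t i).symm)
    · exact Or.inl (relatorWord_eq f t i ▸ h)

/-! ### Soundness of the moves -/

theorem mem_rots {w w' : Word (Fin 46)} : w' ∈ rots w ↔ w ~r w' := by
  rw [List.isRotated_iff_mod, rots, List.mem_map]
  constructor
  · rintro ⟨n, hn, rfl⟩
    have hn : n ≤ w.length := by simpa [Nat.lt_succ_iff] using hn
    exact ⟨n, hn, List.rotate_eq_drop_append_take hn⟩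
  · rintro ⟨n, hn, rfl⟩
    exact ⟨n, by simpa [Nat.lt_succ_iff] using hn, (List.rotate_eq_drop_append_take hn).symm⟩

theorem mkG_append (f t : ℕ → ℕ) (u v : Word (Fin 46)) :
    mkG f t (u ++ v) = mkG f t u * mkG f t v := by
  simp only [mkG, ← FreeGroup.mul_mk, QuotientGroup.mk_mul]

theorem mkG_inv (f t : ℕ → ℕ) (u : Word (Fin 46)) :
    mkG f t (wordInv u) = (mkG f t u)⁻¹ := by
  simp only [mkG, wordInv, ← FreeGroup.inv_mk, QuotientGroup.mk_inv]

theorem mkG_rot (f t : ℕ → ℕ) {w w' : Word (Fin 46)} (h : w ~r w') :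
    IsConj (mkG f t w) (mkG f t w') := by
  obtain ⟨n, hn, rfl⟩ := List.isRotated_iff_mod.1 h
  rw [List.rotate_eq_drop_append_take hn]
  conv_lhs => rw [← List.take_append_drop n w]
  rw [mkG_append, mkG_append]
  refine isConj_iff.2 ⟨(mkG f t (w.take n))⁻¹, by group⟩

theorem mkG_rel {f t : ℕ → ℕ} {r : Word (Fin 46)} (h : r ∈ RS f t) : mkG f t r = 1 := by
  obtain ⟨_, ⟨i, hi, rfl⟩, h⟩ := h
  have h1 : mkG f t (relatorWord f t i) = 1 := by
    refine (QuotientGroup.eq_one_iff _).2 (Subgroup.subset_normalClosure ⟨i, hi, rfl⟩)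
  rcases h with h | h
  · have := mkG_rot f t h
    rw [h1] at this
    exact isConj_one_right.1 this.symm
  · have := mkG_rot f t h
    rw [mkG_inv, h1, inv_one] at this
    exact isConj_one_right.1 this.symm

theorem mem_triv {r : Word (Fin 46)} : r ∈ triv ↔ ∃ x : Ltr, r = [x, (x.1, !x.2)] := by
  simp only [triv, List.mem_flatMap]
  constructor
  · rintro ⟨x, -, h⟩
    simp only [List.mem_cons, List.not_mem_nil, or_false] at h
    rcases h with rfl | rfl
    · exact ⟨(x, true), rfl⟩
    · exact ⟨(x, false), rfl⟩
  · rintro ⟨⟨x, b⟩, rfl⟩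
    exact ⟨x, List.mem_finRange x, by cases b <;> simp⟩

theorem mem_rels_tab {f t : ℕ → ℕ} {n : ℕ} {r : Word (Fin 46)} :
    r ∈ rels (tab f t n) ↔ (∃ x : Ltr, r = [x, (x.1, !x.2)]) ∨
      ∃ i, 1 ≤ i ∧ i ≤ n ∧ ∃ o, r ~r ex (spec o) (f i, i, t i) := by
  simp only [rels, List.mem_append, mem_triv, List.mem_flatMap, tab, List.mem_map, List.mem_range]
  refine or_congr Iff.rfl ?_
  constructor
  · rintro ⟨_, ⟨i, hi, rfl⟩, h | h⟩
    · exact ⟨i + 1, by omega, by omega, true, (mem_rots.1 h).symm⟩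
    · exact ⟨i + 1, by omega, by omega, false, (mem_rots.1 h).symm⟩
  · rintro ⟨i, h1, h2, o, h⟩
    obtain ⟨k, rfl⟩ : ∃ k, i = k + 1 := ⟨i - 1, by omega⟩
    refine ⟨_, ⟨k, by omega, rfl⟩, ?_⟩
    cases o
    · exact Or.inr (mem_rots.2 h.symm)
    · exact Or.inl (mem_rots.2 h.symm)

theorem mkG_rels {f t : ℕ → ℕ} {n : ℕ} {r : Word (Fin 46)} (h : r ∈ rels (tab f t n)) :
    mkG f t r = 1 := by
  rcases mem_rels_tab.1 h with ⟨x, rfl⟩ | ⟨i, h1, -, o, h⟩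
  · have h2 : ([x, (x.1, !x.2)] : Word (Fin 46)) = [x] ++ wordInv [x] := by
      simp [wordInv, FreeGroup.invRev]
    rw [h2, mkG_append, mkG_inv, mul_inv_cancel]
  · exact mkG_rel (mem_RS.2 ⟨i, h1, o, h⟩)

theorem mkG_cand {f t : ℕ → ℕ} {r : Word (Fin 46)} (h : mkG f t r = 1) (w : Word (Fin 46))
    (m : ℕ) : mkG f t (cand w r m) = mkG f t w := by
  unfold cand
  split_ifs with hc
  · conv_rhs => rw [← List.take_append_drop m w, hc]
    rw [← List.take_append_drop m r, mkG_append] at h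
    rw [mkG_append, mkG_append, mkG_inv, eq_inv_of_mul_eq_one_left h]
  · rfl

theorem pick_spec (L : List (Word (Fin 46))) (p : Word (Fin 46) → Bool) (w : Word (Fin 46)) :
    (pick L p w ∈ L ∧ p (pick L p w) = true) ∨ (pick L p w = w ∧ ∀ c ∈ L, p c = false) := by
  unfold pick
  by_cases h : L.findIdx p < L.length
  · left
    rw [List.getElem?_eq_getElem h]
    exact ⟨List.getElem_mem h, List.findIdx_getElem⟩
  · right
    rw [List.getElem?_eq_none (by omega)]
    refine ⟨rfl, ?_⟩
    have := List.findIdx_eq_length.1 (le_antisymm List.findIdx_le_length (not_lt.1 h))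
    simpa using this

theorem mem_moves {T : List (ℕ × ℕ × ℕ)} {w c : Word (Fin 46)} :
    c ∈ moves T w ↔ ∃ w', w ~r w' ∧ ∃ r ∈ rels T, ∃ m ≤ r.length, c = cand w' r m := by
  simp only [moves, List.mem_flatMap, List.mem_map, List.mem_range, mem_rots, Nat.lt_succ_iff]
  grind

theorem step_conj (f t : ℕ → ℕ) (n : ℕ) (w : Word (Fin 46)) :
    IsConj (mkG f t (step (tab f t n) w)) (mkG f t w) := by
  rcases pick_spec (moves (tab f t n) w) (fun c => decide (c.length < w.length)) w with h | h
  · obtain ⟨w', hw, r, hr, m, -, hc⟩ := mem_moves.1 h.1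
    unfold step
    rw [hc, mkG_cand (mkG_rels hr)]
    exact (mkG_rot f t hw).symm
  · unfold step
    rw [h.1]

theorem run_conj (f t : ℕ → ℕ) (n : ℕ) (w : Word (Fin 46)) :
    IsConj (mkG f t (run (tab f t n) w)) (mkG f t w) := by
  have : ∀ k, IsConj (mkG f t ((step (tab f t n))^[k] w)) (mkG f t w) := by
    intro k
    induction k with
    | zero => exact IsConj.refl _
    | succ k ih =>
      rw [Function.iterate_succ_apply']
      exact (step_conj f t n _).trans ih
  exact this _

theorem fin_rot (w : Word (Fin 46)) : w ~r fin w := by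
  unfold fin
  rcases pick_spec (rots w) (fun c => !decide (c.head?.map Prod.fst
    = c.reverse.head?.map Prod.fst)) w with h | h
  · exact mem_rots.1 h.1
  · rw [h.1]

theorem rho_conj (f t : ℕ → ℕ) (w : Word (Fin 46)) :
    IsConj (mkG f t (rho f t w)) (mkG f t w) :=
  (mkG_rot f t (fin_rot _)).symm.trans (run_conj f t _ w)

/-! ### The result of the iteration is Dehn reduced -/

theorem run_spec (T : List (ℕ × ℕ × ℕ)) (w : Word (Fin 46)) :
    (run T w).length ≤ w.length ∧ ∀ c ∈ moves T (run T w), (run T w).length ≤ c.length := by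
  have key : ∀ k, ((step T)^[k] w).length + k ≤ w.length ∨
      (((step T)^[k] w).length ≤ w.length ∧
        ∀ c ∈ moves T ((step T)^[k] w), ((step T)^[k] w).length ≤ c.length) := by
    intro k
    induction k with
    | zero => left; simp
    | succ k ih =>
      rw [Function.iterate_succ_apply']
      set v := (step T)^[k] w
      rcases pick_spec (moves T v) (fun c => decide (c.length < v.length)) v with h | h
      · have h1 : (step T v).length < v.length := of_decide_eq_true h.2
        have h2 := h.1
        rcases ih with ih | ih
        · left; omega
        · have := ih.2 _ h2
          unfold step at h1
          omega
      · have h1 : step T v = v := h.1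
        rw [h1]
        right
        refine ⟨by omega, fun c hc => ?_⟩
        simpa using h.2 c hc
  rcases key w.length with h | h
  · have h0 : (run T w).length = 0 := by unfold run; omega
    rw [h0]
    exact ⟨by omega, fun c _ => by omega⟩
  · exact h

/-- Dehn reduced cyclic words. -/
def Good (R : Set (Word (Fin 46))) (w : Word (Fin 46)) : Prop :=
  ∀ w', w ~r w' → (∀ x : Ltr, ∀ v, w' ≠ x :: (x.1, !x.2) :: v) ∧
    ∀ s v tl, w' = s ++ v → s ++ tl ∈ R → s.length ≤ tl.length

theorem cand_pre (s v tl : Word (Fin 46)) :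
    cand (s ++ v) (s ++ tl) s.length = wordInv tl ++ v := by
  simp [cand]

theorem length_wordInv (u : Word (Fin 46)) : (wordInv u).length = u.length := by
  simp [wordInv]

theorem le_length_ex (o : Bool) (e : ℕ × ℕ × ℕ) :
    e.2.1 ≤ (ex (spec o) e).length := by
  rw [spec, ex_append, ex_append, ex_append]
  have : e.2.1 ≤ (ex lC e).length := by
    rw [← conjWord_eq]
    simp [conjWord, genPow]
  simp only [List.length_append]
  omega

theorem run_good (f t : ℕ → ℕ) (w : Word (Fin 46)) :
    Good (RS f t) (run (tab f t (2 * w.length + 1)) w) := by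
  obtain ⟨hl, hm⟩ := run_spec (tab f t (2 * w.length + 1)) w
  set z := run (tab f t (2 * w.length + 1)) w
  intro w' hw
  have hlen := hw.perm.length_eq
  refine ⟨?_, ?_⟩
  · rintro x v rfl
    have := hm _ (mem_moves.2 ⟨_, hw, [x, (x.1, !x.2)], mem_rels_tab.2 (Or.inl ⟨x, rfl⟩), 2,
      by simp, rfl⟩)
    have h2 := cand_pre [x, (x.1, !x.2)] v []
    simp only [List.append_nil, List.length_cons, List.length_nil, List.cons_append,
      List.nil_append, Nat.zero_add, Nat.reduceAdd] at h2
    rw [h2] at this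
    simp [wordInv] at this hlen
    omega
  · rintro s v tl rfl hr
    by_contra hlt
    obtain ⟨i, hi, o, hrot⟩ := mem_RS.1 hr
    have h1 := le_length_ex o (f i, i, t i)
    have h2 := hrot.perm.length_eq
    simp only [List.length_append] at h1 h2 hlen
    have := hm _ (mem_moves.2 ⟨_, hw, s ++ tl, mem_rels_tab.2 (Or.inr ⟨i, hi, by omega, o, hrot⟩),
      s.length, by simp, rfl⟩)
    rw [cand_pre, List.length_append, length_wordInv] at this
    omega

theorem Good.rot {R : Set (Word (Fin 46))} {w w' : Word (Fin 46)} (h : Good R w) (hw : w ~r w') :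
    Good R w' := fun w'' h' => h w'' (hw.trans h')

theorem Good.isReduced {R : Set (Word (Fin 46))} {w : Word (Fin 46)} (h : Good R w) :
    FreeGroup.IsReduced w := by
  rw [FreeGroup.isReduced_iff_not_step]
  intro L hL
  cases hL with
  | @not u v x b =>
    exact (h ((x, b) :: (x, !b) :: v ++ u) List.isRotated_append).1 (x, b) (v ++ u) (by simp)

theorem Good.cyc {R : Set (Word (Fin 46))} {w : Word (Fin 46)} (h : Good R w) :
    CyclicallyReduced w := by
  refine ⟨h.isReduced.reduce_eq, ?_⟩
  intro a ha b hb hab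
  rcases List.eq_nil_or_concat w with rfl | ⟨u, c, rfl⟩
  · simp at ha
  · have hc : c = b := by simpa using hb
    subst hc
    cases u with
    | nil =>
      have : c = a := by simpa using ha
      subst this
      exact absurd (congrArg Prod.snd hab) (by simp)
    | cons d u =>
      have : d = a := by simpa using ha
      subst this
      refine (h (c :: d :: u) ?_).1 c u (by rw [hab])
      simpa using (List.isRotated_append (l := d :: u) (l' := [c]))

theorem fin_spec {R : Set (Word (Fin 46))} {w : Word (Fin 46)} (h : Good R w) :
    IsGenPower (fin w) ∨ ∀ a ∈ (fin w).head?, ∀ b ∈ (fin w).getLast?, a.1 ≠ b.1 := by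
  rcases pick_spec (rots w) (fun c => !decide (c.head?.map Prod.fst
    = c.reverse.head?.map Prod.fst)) w with h1 | h1
  · right
    have h2 : ¬ ((fin w).head?.map Prod.fst = (fin w).reverse.head?.map Prod.fst) := by
      have h3 : (!decide ((fin w).head?.map Prod.fst = (fin w).reverse.head?.map Prod.fst))
        = true := h1.2
      simpa only [Bool.not_eq_true', decide_eq_false_iff_not] using h3
    intro a ha b hb hab
    apply h2
    rw [List.head?_reverse, Option.mem_def.1 ha, Option.mem_def.1 hb]
    simp [hab]
  · left
    have h2 : fin w = w := h1.1
    rw [h2]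
    have h3 : List.IsChain (· = ·) w := by
      rw [List.isChain_iff_forall_rel_of_append_cons_cons]
      rintro a b u v rfl
      have h4 : u ++ a :: b :: v ~r b :: v ++ (u ++ [a]) := by
        simpa using (List.isRotated_append (l := u ++ [a]) (l' := b :: v))
      have h5 := h1.2 _ (mem_rots.2 h4)
      have h6 : b.1 = a.1 := by simpa using h5
      have h7 := h.isReduced
      rw [FreeGroup.IsReduced, List.isChain_iff_forall_rel_of_append_cons_cons] at h7
      exact Prod.ext h6.symm (h7 rfl h6.symm)
    rw [List.isChain_eq_iff_eq_replicate] at h3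
    cases w with
    | nil => exact ⟨(0, true), 0, rfl⟩
    | cons x w => exact ⟨x, _, h3 x rfl⟩

/-! ### Pieces -/

def ab (x : Ltr) : Bool := decide (x.1.val < 40)

theorem rep_inj {x z : Ltr} (hz : z ≠ x) {K A : Word (Fin 46)} (hK : x ∉ K) :
    ∀ m n : ℕ, List.replicate m x ++ z :: A = List.replicate n x ++ K → m = n ∧ z :: A = K
  | 0, 0, h => ⟨rfl, by simpa using h⟩
  | 0, n + 1, h => by simp [List.replicate_succ, hz] at h
  | m + 1, 0, h => by
    exfalso
    apply hK
    simp only [List.replicate_succ, List.replicate_zero, List.nil_append, List.cons_append] at h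
    rw [← h]
    simp
  | m + 1, n + 1, h => by
    simp only [List.replicate_succ, List.cons_append, List.cons.injEq, true_and] at h
    have := rep_inj hz hK m n h
    exact ⟨by omega, this.2⟩

theorem block {x y z : Ltr} (hy : y ≠ x) (hz : z ≠ x) {r P Q p q : Word (Fin 46)} {m n : ℕ}
    (hP : x ∉ P) (hQ : x ∉ Q) (hr : r ~r P ++ (List.replicate n x ++ Q))
    (he : r = p ++ y :: (List.replicate (m + 1) x ++ z :: q)) :
    m + 1 = n ∧ z :: (q ++ p ++ [y]) = Q ++ P := by
  have hK : x ∉ Q ++ P := by simp [hP, hQ]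
  have h1 : List.replicate n x ++ (Q ++ P) ~r
      List.replicate (m + 1) x ++ z :: (q ++ p ++ [y]) := by
    have a1 : List.replicate n x ++ (Q ++ P) ~r r := by
      refine List.IsRotated.trans ?_ hr.symm
      simpa using (List.isRotated_append (l := List.replicate n x ++ Q) (l' := P))
    refine a1.trans ?_
    rw [he]
    simpa using (List.isRotated_append (l := p ++ [y])
      (l' := List.replicate (m + 1) x ++ z :: q))
  refine rep_inj hz hK (m + 1) n ?_
  obtain ⟨k, hk, h2⟩ := List.isRotated_iff_mod.1 h1
  rw [List.rotate_eq_drop_append_take hk] at h2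
  set D := List.replicate n x ++ (Q ++ P) with hD
  have hs : D.take k ++ D.drop k = List.replicate n x ++ (Q ++ P) := by
    rw [List.take_append_drop]
  have hcat : D.take k ++ D.drop k = D := List.take_append_drop k D
  by_cases e1 : D.take k = []
  · rw [e1, List.nil_append] at hcat
    rw [e1, List.append_nil, hcat] at h2
    exact h2.symm
  by_cases e2 : D.drop k = []
  · rw [e2, List.append_nil] at hcat
    rw [e2, List.nil_append, hcat] at h2
    exact h2.symm
  exfalso
  have hx : x ∈ D.drop k := by
    have := congrArg List.head? h2
    rw [List.head?_append_of_ne_nil _ e2] at this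
    simp [List.replicate_succ] at this
    rw [← List.head?_drop] at this
    exact List.mem_of_mem_head? this
  have hl : (D.take k).getLast? = some y := by
    have := congrArg List.getLast? h2
    rw [List.getLast?_append_of_ne_nil _ e1] at this
    rw [this]
    have h3 : List.replicate (m + 1) x ++ z :: (q ++ p ++ [y])
      = (List.replicate (m + 1) x ++ z :: (q ++ p)) ++ [y] := by simp
    rw [h3, List.getLast?_concat]
  rcases List.append_eq_append_iff.1 hs with ⟨a', h3, h4⟩ | ⟨c', h3, h4⟩
  · have : y ∈ List.replicate n x := by
      rw [h3]
      exact List.mem_append_left _ (List.mem_of_getLast? hl)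
    exact hy (List.eq_of_mem_replicate this)
  · apply hK
    rw [h4]
    exact List.mem_append_right _ hx

theorem inner_block {x : Ltr} {b : Word (Fin 46)} (hx : x ∈ b) (hh : b.head? ≠ some x)
    (hl : b.getLast? ≠ some x) :
    ∃ p y m z q, b = p ++ y :: (List.replicate (m + 1) x ++ z :: q) ∧ y ≠ x ∧ z ≠ x := by
  obtain ⟨u, v, rfl, hu⟩ := List.eq_append_cons_of_mem hx
  rcases List.eq_nil_or_concat u with rfl | ⟨p, y, rfl⟩
  · simp at hh
  have hy : y ≠ x := by
    rintro rfl
    simp at hu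
  have hv : ∀ v : Word (Fin 46), (x :: v).getLast? ≠ some x →
      ∃ m z q, x :: v = List.replicate (m + 1) x ++ z :: q ∧ z ≠ x := by
    intro v
    induction v with
    | nil => intro h; simp at h
    | cons a v ih =>
      intro h
      by_cases ha : a = x
      · subst ha
        rw [List.getLast?_cons_cons] at h
        obtain ⟨m, z, q, h1, h2⟩ := ih h
        exact ⟨m + 1, z, q, by rw [h1, List.replicate_succ (n := m + 1)]; rfl, h2⟩
      · exact ⟨0, a, v, by simp, ha⟩
  have hl' : (x :: v).getLast? ≠ some x := by
    rwa [List.getLast?_append_of_ne_nil _ (by simp)] at hl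
  obtain ⟨m, z, q, h1, h2⟩ := hv v hl'
  exact ⟨p, y, m, z, q, by rw [h1]; simp, hy, h2⟩

theorem spec_nodup (o : Bool) : ((spec o).map Prod.fst).Nodup := by
  cases o <;> decide +kernel

theorem spec_ab : ∀ o : Bool, ∀ p ∈ spec o, ab p.1 = true → p.2 = 0 := by
  decide +kernel

theorem spec_or : ∀ o o' : Bool, ∀ p ∈ spec o, ∀ p' ∈ spec o', p.1 = p'.1 → ab p.1 = true →
    o = o' := by
  decide +kernel

theorem mem_ex {L : List (Ltr × Fin 3)} {e : ℕ × ℕ × ℕ} {x : Ltr} (h : x ∈ ex L e) :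
    ∃ k, (x, k) ∈ L := by
  simp only [ex, List.mem_flatMap, List.mem_replicate] at h
  obtain ⟨⟨y, k⟩, h1, -, h2⟩ := h
  simp only at h2
  exact ⟨k, h2 ▸ h1⟩

theorem spec_split {o : Bool} {x : Ltr} {k : Fin 3} (h : (x, k) ∈ spec o) :
    ∃ L M, (∀ e, ex (spec o) e = ex L e ++ (List.replicate (ev e k) x ++ ex M e)) ∧
      (∀ e, x ∉ ex L e) ∧ ∀ e, x ∉ ex M e := by
  obtain ⟨L, M, hLM⟩ := List.append_of_mem h
  have hn := spec_nodup o
  rw [hLM, List.map_append, List.map_cons, List.nodup_middle] at hn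
  have hn1 := (List.nodup_cons.1 hn).1
  simp only [List.mem_append, not_or] at hn1
  refine ⟨L, M, fun e => by rw [hLM, ex_append, ex_cons], fun e hx => ?_, fun e hx => ?_⟩
  · obtain ⟨k', hk⟩ := mem_ex hx
    exact hn1.1 (List.mem_map_of_mem hk)
  · obtain ⟨k', hk⟩ := mem_ex hx
    exact hn1.2 (List.mem_map_of_mem hk)

theorem piece_ab {f t : ℕ → ℕ} (hf : Function.Injective f) {b : Word (Fin 46)}
    (hb : Piece (RS f t) b) {x : Ltr} (hx : x ∈ b) (hab : ab x = true) :
    b.head? = some x ∨ b.getLast? = some x := by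
  by_contra hcon
  rw [not_or] at hcon
  obtain ⟨p, y, m, z, q, rfl, hy, hz⟩ := inner_block hx hcon.1 hcon.2
  obtain ⟨-, r₁, hr₁, r₂, hr₂, hne, ⟨c₁, rfl⟩, ⟨c₂, rfl⟩⟩ := hb
  obtain ⟨i₁, -, o₁, h₁⟩ := mem_RS.1 hr₁
  obtain ⟨i₂, -, o₂, h₂⟩ := mem_RS.1 hr₂
  obtain ⟨k₁, hk₁⟩ := mem_ex (h₁.mem_iff.1 (List.mem_append_left c₁ hx))
  obtain ⟨k₂, hk₂⟩ := mem_ex (h₂.mem_iff.1 (List.mem_append_left c₂ hx))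
  have ho := spec_or o₁ o₂ _ hk₁ _ hk₂ rfl hab
  subst ho
  have hk0 : k₁ = 0 := spec_ab _ _ hk₁ hab
  subst hk0
  obtain ⟨L, M, hLM, hL, hM⟩ := spec_split hk₁
  rw [hLM] at h₁ h₂
  have b₁ := block (q := q ++ c₁) (m := m) (p := p) hy hz (hL _) (hM _) h₁ (by simp)
  have b₂ := block (q := q ++ c₂) (m := m) (p := p) hy hz (hL _) (hM _) h₂ (by simp)
  have hi : i₁ = i₂ := hf (b₁.1.symm.trans b₂.1)
  subst hi
  have h3 := b₁.2.trans b₂.2.symm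
  simp only [List.cons.injEq, true_and, List.append_assoc, List.append_cancel_left_eq] at h3
  rw [List.append_cancel_right_eq] at h3
  exact hne (by rw [h3])

theorem card_ab {f t : ℕ → ℕ} (hf : Function.Injective f) {w : Word (Fin 46)}
    {bs : List (Word (Fin 46))} (h : MaxPieceFact (RS f t) w bs) :
    (w.toFinset.filter (fun x => ab x = true)).card ≤ 2 * bs.length := by
  induction h with
  | nil => simp
  | @cons b rest bs hb hmax ht ih =>
    rw [List.toFinset_append, Finset.filter_union]
    have h1 : (b.toFinset.filter (fun x => ab x = true)).card ≤ 2 := by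
      have hsub : b.toFinset.filter (fun x => ab x = true) ⊆
          b.head?.toFinset ∪ b.getLast?.toFinset := by
        intro x hx
        simp only [Finset.mem_filter, List.mem_toFinset] at hx
        simpa using piece_ab hf hb hx.1 hx.2
      have c1 : b.head?.toFinset.card ≤ 1 := by cases b.head? <;> simp
      have c2 : b.getLast?.toFinset.card ≤ 1 := by cases b.getLast? <;> simp
      have := (Finset.card_le_card hsub).trans (Finset.card_union_le _ _)
      omega
    have := Finset.card_union_le (b.toFinset.filter (fun x => ab x = true))
      (rest.toFinset.filter (fun x => ab x = true))
    simp only [List.length_cons]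
    omega

/-! ### Counting letters -/

def lab (x : Ltr) : ℕ :=
  if x.1.val < 20 then 0 else if x.1.val < 40 then 2 else if x.2 then 1 else 3

theorem countP_ex (q : Ltr → Bool) (L : List (Ltr × Fin 3)) (e : ℕ × ℕ × ℕ) :
    (ex L e).countP q = (((L.filter fun p => q p.1).map Prod.snd).map (ev e)).sum := by
  induction L with
  | nil => rfl
  | cons p L ih =>
    rw [ex_cons, List.countP_append, ih, List.countP_replicate, List.filter_cons]
    split_ifs <;> simp

theorem length_base (o : Bool) (e : ℕ × ℕ × ℕ) :
    (ex (spec o) e).length = 40 * e.1 + 6 * e.2.1 + 6 * e.2.2 := by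
  have h := countP_ex (fun _ => true) (spec o) e
  have h2 : ((spec o).filter fun p => (fun _ : Ltr => true) p.1).map Prod.snd
      = List.replicate 20 0 ++ [1, 2, 1, 2, 1, 2] ++ List.replicate 20 0
        ++ [2, 1, 2, 1, 2, 1] := by cases o <;> decide +kernel
  rw [h2] at h
  rw [List.countP_true] at h
  rw [h, List.map_append, List.map_append, List.map_append, List.map_replicate, List.sum_append,
    List.sum_append, List.sum_append, List.sum_replicate]
  simp only [List.map_cons, List.map_nil, List.sum_cons, List.sum_nil, smul_eq_mul]
  have e0 : ev e 0 = e.1 := rfl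
  have e1 : ev e 1 = e.2.1 := rfl
  have e2 : ev e 2 = e.2.2 := rfl
  rw [e0, e1, e2]
  omega

theorem countOne_base (o : Bool) (e : ℕ × ℕ × ℕ) :
    (ex (spec o) e).countP (fun x => lab x == 1) = 3 * e.2.1 + 3 * e.2.2 := by
  have h2 : ((spec o).filter fun p => (fun x : Ltr => lab x == 1) p.1).map Prod.snd
      = [1, 2, 1, 2, 1, 2] := by cases o <;> decide +kernel
  rw [countP_ex, h2]
  simp [ev]
  omega

theorem countThree_base (o : Bool) (e : ℕ × ℕ × ℕ) :
    (ex (spec o) e).countP (fun x => lab x == 3) = 3 * e.2.1 + 3 * e.2.2 := by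
  have h2 : ((spec o).filter fun p => (fun x : Ltr => lab x == 3) p.1).map Prod.snd
      = [2, 1, 2, 1, 2, 1] := by cases o <;> decide +kernel
  rw [countP_ex, h2]
  simp [ev]
  omega

theorem count_base {o : Bool} {e : ℕ × ℕ × ℕ} {x : Ltr} (hab : ab x = true) :
    (ex (spec o) e).count x ≤ e.1 := by
  by_cases hx : x ∈ ex (spec o) e
  · obtain ⟨k, hk⟩ := mem_ex hx
    have hk0 : k = 0 := spec_ab _ _ hk hab
    subst hk0
    obtain ⟨L, M, hLM, hL, hM⟩ := spec_split hk
    rw [hLM, List.count_append, List.count_append, List.count_eq_zero_of_not_mem (hL e),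
      List.count_eq_zero_of_not_mem (hM e)]
    simp [ev]
  · rw [List.count_eq_zero_of_not_mem hx]
    omega

theorem countP_split (w : Word (Fin 46)) : w.length = w.countP ab +
    w.countP (fun x => lab x == 1) + w.countP (fun x => lab x == 3) := by
  induction w with
  | nil => rfl
  | cons x w ih =>
    simp only [List.countP_cons, List.length_cons]
    rw [ih]
    have : (if ab x = true then 1 else 0) + (if (lab x == 1) = true then 1 else 0)
        + (if (lab x == 3) = true then 1 else 0) = 1 := by
      unfold ab lab
      by_cases h1 : x.1.val < 20 <;> by_cases h2 : x.1.val < 40 <;> cases x.2 <;>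
        simp [h1, h2] <;> omega
    omega

theorem lab_A : ∀ o, ∀ p ∈ lA o, lab p.1 = 0 := by decide +kernel
theorem lab_B : ∀ o, ∀ p ∈ lB o, lab p.1 = 2 := by decide +kernel
theorem lab_C : ∀ p ∈ lC, lab p.1 = 1 := by decide +kernel
theorem lab_C' : ∀ p ∈ lC', lab p.1 = 3 := by decide +kernel

theorem lab_ex {L : List (Ltr × Fin 3)} {n : ℕ} (h : ∀ p ∈ L, lab p.1 = n) (e : ℕ × ℕ × ℕ) :
    ∀ x ∈ ex L e, lab x = n := by
  intro x hx
  obtain ⟨k, hk⟩ := mem_ex hx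
  exact h _ hk

theorem loc {X Y Z V : Word (Fin 46)} (hX : ∀ x ∈ X, lab x = 0) (hY : ∀ x ∈ Y, lab x = 1)
    (hZ : ∀ x ∈ Z, lab x = 2) (hV : ∀ x ∈ V, lab x = 3) {p : ℕ} {a : Ltr}
    (h : (X ++ Y ++ Z ++ V)[p]? = some a) :
    (lab a = 0 ∧ p < X.length) ∨
    (lab a = 1 ∧ X.length ≤ p ∧ p < X.length + Y.length) ∨
    (lab a = 2 ∧ X.length + Y.length ≤ p ∧ p < X.length + Y.length + Z.length) ∨
    (lab a = 3 ∧ X.length + Y.length + Z.length ≤ p) := by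
  rw [List.getElem?_append, List.getElem?_append, List.getElem?_append] at h
  simp only [List.length_append] at h
  split_ifs at h with h1 h2 h3
  · exact Or.inl ⟨hX _ (List.mem_of_getElem? h), h3⟩
  · exact Or.inr (Or.inl ⟨hY _ (List.mem_of_getElem? h), by omega, by omega⟩)
  · exact Or.inr (Or.inr (Or.inl ⟨hZ _ (List.mem_of_getElem? h), by omega, by omega⟩))
  · exact Or.inr (Or.inr (Or.inr ⟨hV _ (List.mem_of_getElem? h), by omega⟩))

theorem rot_idx {B r : Word (Fin 46)} {n q : ℕ} {a : Ltr} (hn : n ≤ B.length)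
    (h : B.rotate n = r) (hq : r[q]? = some a) :
    ∃ p, B[p]? = some a ∧ p < B.length ∧ q < B.length ∧ (p = q + n ∨ p + B.length = q + n) := by
  subst h
  have hq' : q < B.length := by
    have := (List.getElem?_eq_some_iff.1 hq).1
    simpa using this
  rw [List.getElem?_rotate hq'] at hq
  refine ⟨_, hq, Nat.mod_lt _ (by omega), hq', ?_⟩
  by_cases h : q + n < B.length
  · left; exact Nat.mod_eq_of_lt h
  · right
    rw [Nat.mod_eq_sub_mod (by omega), Nat.mod_eq_of_lt (by omega)]
    omega

theorem alternate {X Y Z V s tl : Word (Fin 46)} (hX : ∀ x ∈ X, lab x = 0)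
    (hY : ∀ x ∈ Y, lab x = 1) (hZ : ∀ x ∈ Z, lab x = 2) (hV : ∀ x ∈ V, lab x = 3)
    (hr : s ++ tl ~r X ++ Y ++ Z ++ V) {x y z v : Ltr} (hx : x ∈ s) (hz : z ∈ s) (hy : y ∈ tl)
    (hv : v ∈ tl) (lx : lab x = 0) (ly : lab y = 1) (lz : lab z = 2) (lv : lab v = 3) :
    False := by
  obtain ⟨n, hn, hB⟩ := List.isRotated_iff_mod.1 hr.symm
  have ins : ∀ a ∈ s, ∃ q, q < s.length ∧ (s ++ tl)[q]? = some a := by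
    intro a ha
    obtain ⟨q, hq⟩ := List.mem_iff_getElem?.1 ha
    have hlt := (List.getElem?_eq_some_iff.1 hq).1
    exact ⟨q, hlt, by rw [List.getElem?_append_left hlt]; exact hq⟩
  have int : ∀ a ∈ tl, ∃ q, s.length ≤ q ∧ (s ++ tl)[q]? = some a := by
    intro a ha
    obtain ⟨q, hq⟩ := List.mem_iff_getElem?.1 ha
    refine ⟨s.length + q, by omega, ?_⟩
    rw [List.getElem?_append_right (by omega)]
    simpa using hq
  obtain ⟨qx, hqx, ex⟩ := ins x hx
  obtain ⟨qz, hqz, ez⟩ := ins z hz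
  obtain ⟨qy, hqy, ey⟩ := int y hy
  obtain ⟨qv, hqv, ev⟩ := int v hv
  obtain ⟨px, gx, px1, px2, px3⟩ := rot_idx hn hB ex
  obtain ⟨py, gy, py1, py2, py3⟩ := rot_idx hn hB ey
  obtain ⟨pz, gz, pz1, pz2, pz3⟩ := rot_idx hn hB ez
  obtain ⟨pv, gv, pv1, pv2, pv3⟩ := rot_idx hn hB ev
  have kx := loc hX hY hZ hV gx
  have ky := loc hX hY hZ hV gy
  have kz := loc hX hY hZ hV gz
  have kv := loc hX hY hZ hV gv
  rw [lx] at kx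
  rw [ly] at ky
  rw [lz] at kz
  rw [lv] at kv
  simp at kx ky kz kv
  clear hB gx gy gz gv ex ey ez ev ins int
  generalize (X ++ Y ++ Z ++ V).length = N at *
  omega

theorem missing {e : ℕ × ℕ × ℕ} (he : 1 ≤ e.1) {s tl r : Word (Fin 46)} (hr : s ++ tl ~r r)
    (L : List (Ltr × Fin 3)) (hL : ex L e ⊆ r)
    (h0 : ∀ p ∈ L, p.2 = 0) (hab : ∀ p ∈ L, ab p.1 = true)
    (hc : (L.map Prod.fst).toFinset.card = 20)
    (h14 : (tl.toFinset.filter (fun x => ab x = true)).card ≤ 14) :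
    ∃ p ∈ L, p.1 ∈ s := by
  by_contra hcon
  push Not at hcon
  have hsub : (L.map Prod.fst).toFinset ⊆ tl.toFinset.filter (fun x => ab x = true) := by
    intro x hx
    simp only [List.mem_toFinset, List.mem_map] at hx
    obtain ⟨p, hp, rfl⟩ := hx
    simp only [Finset.mem_filter, List.mem_toFinset]
    refine ⟨?_, hab p hp⟩
    have h1 : p.1 ∈ ex L e := by
      simp only [ex, List.mem_flatMap, List.mem_replicate]
      refine ⟨p, hp, ?_, rfl⟩
      rw [h0 p hp]
      simp [ev]
      omega
    have h2 := hr.mem_iff.2 (hL h1)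
    rcases List.mem_append.1 h2 with h | h
    · exact absurd h (hcon p hp)
    · exact h
  have := Finset.card_le_card hsub
  omega

theorem lA_prop : ∀ o, (∀ p ∈ lA o, p.2 = 0) ∧ (∀ p ∈ lA o, ab p.1 = true) ∧
    ((lA o).map Prod.fst).toFinset.card = 20 := by decide +kernel

theorem lB_prop : ∀ o, (∀ p ∈ lB o, p.2 = 0) ∧ (∀ p ∈ lB o, ab p.1 = true) ∧
    ((lB o).map Prod.fst).toFinset.card = 20 := by decide +kernel

theorem tail_short {e : ℕ × ℕ × ℕ} (he : 1 ≤ e.1) {o : Bool} {s tl : Word (Fin 46)}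
    (hr : s ++ tl ~r ex (spec o) e)
    (h14 : (tl.toFinset.filter (fun x => ab x = true)).card ≤ 14) : tl.length < s.length := by
  have hlen := hr.perm.length_eq
  rw [length_base, List.length_append] at hlen
  have hsplit := countP_split tl
  have hle : ∀ q : Ltr → Bool, tl.countP q ≤ (ex (spec o) e).countP q := by
    intro q
    rw [← hr.perm.countP_eq, List.countP_append]
    omega
  have h1 := hle (fun x => lab x == 1)
  have h3 := hle (fun x => lab x == 3)
  rw [countOne_base] at h1
  rw [countThree_base] at h3
  have hA : tl.countP ab ≤ 14 * e.1 := by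
    rw [List.countP_eq_length_filter, ← List.sum_toFinset_count_eq_length]
    have hf : (tl.filter ab).toFinset = tl.toFinset.filter (fun x => ab x = true) := by
      ext x; simp
    calc _ ≤ ∑ x ∈ (tl.filter ab).toFinset, e.1 := by
          refine Finset.sum_le_sum fun x hx => ?_
          have hx' : ab x = true := by
            simp at hx
            exact hx.2
          refine le_trans ?_ (count_base (o := o) hx')
          have hinst : ∀ l : List Ltr, @List.count Ltr instBEqOfDecidableEq x l = l.count x := by
            intro l
            induction l with
            | nil => rfl
            | cons a l ih => simp only [List.count_cons, ih, beq_iff_eq]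
          rw [hinst]
          exact (List.Sublist.count_le x List.filter_sublist).trans (hle _)
      _ ≤ _ := by
          rw [Finset.sum_const, hf, smul_eq_mul]
          exact Nat.mul_le_mul_right _ h14
  have hor : tl.countP (fun x => lab x == 1) = 0 ∨ tl.countP (fun x => lab x == 3) = 0 := by
    by_contra hcon
    rw [not_or, ← Ne, ← Ne, ← Nat.pos_iff_ne_zero, ← Nat.pos_iff_ne_zero, List.countP_pos_iff,
      List.countP_pos_iff] at hcon
    obtain ⟨⟨y, hy, ly⟩, ⟨v, hv, lv⟩⟩ := hcon
    have hspec : ex (spec o) e = ex (lA o) e ++ ex lC e ++ ex (lB o) e ++ ex lC' e := by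
      rw [spec, ex_append, ex_append, ex_append]
    obtain ⟨p, hp, hps⟩ := missing he hr (lA o) (by rw [hspec]; intro x hx; simp [hx])
      (lA_prop o).1 (lA_prop o).2.1 (lA_prop o).2.2 h14
    obtain ⟨p', hp', hps'⟩ := missing he hr (lB o) (by rw [hspec]; intro x hx; simp [hx])
      (lB_prop o).1 (lB_prop o).2.1 (lB_prop o).2.2 h14
    rw [hspec] at hr
    exact alternate (lab_ex (lab_A o) e) (lab_ex lab_C e) (lab_ex (lab_B o) e) (lab_ex lab_C' e)
      hr hps hps' hy hv (lab_A o p hp) (by simpa using ly) (lab_B o p' hp') (by simpa using lv)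
  omega

theorem Good.wcr {f t : ℕ → ℕ} (hf : Function.Injective f) (hf1 : ∀ i : ℕ, 1 ≤ i → 1 ≤ f i)
    {w : Word (Fin 46)} (h : Good (RS f t) w) (w' : Word (Fin 46)) (hw : w ~r w') :
    ¬ ContainsAlmostRelator (RS f t) 7 w' := by
  rintro ⟨u, s, v, rfl, r, hr, tl, rfl, l, hl, bs, hbs, rfl⟩
  have hc := card_ab hf hbs
  obtain ⟨i, hi, o, hrot⟩ := mem_RS.1 hr
  have h1 := tail_short (hf1 i hi) hrot (by omega)
  have h2 : w ~r s ++ (v ++ u) := by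
    refine hw.trans ?_
    simpa using (List.isRotated_append (l := u) (l' := s ++ v))
  have := (h _ h2).2 s _ tl rfl hr
  omega

end WCR

/-- If `f` and `t` are computable, there is a computable function `ρ` on words such that
`ρ w` is weakly cyclically `R*`-reduced and the image of `ρ w` in `G` is conjugate to the
image of `w`, where `R*` is the symmetrized closure of `{r_i : i ≥ 1}`. -/
theorem computable_weak_cyclic_reduction (f t : ℕ → ℕ) (hf : Function.Injective f)
    (hf1 : ∀ i : ℕ, 1 ≤ i → 1 ≤ f i) (ht1 : ∀ i : ℕ, 1 ≤ i → 1 ≤ t i)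
    (hfc : Computable f) (htc : Computable t) :
    ∃ ρ : Word (Fin 46) → Word (Fin 46), Computable ρ ∧
      ∀ w : Word (Fin 46),
        WeaklyCyclicallyReduced
          (symClosure {w | ∃ i : ℕ, 1 ≤ i ∧ w = relatorWord f t i}) (ρ w) ∧
        IsConj (mkG f t (ρ w)) (mkG f t w) := by
  refine ⟨WCR.rho f t, WCR.comp_rho hfc htc, fun w => ⟨?_, WCR.rho_conj f t w⟩⟩
  have hg := WCR.run_good f t w
  have hg' : WCR.Good (WCR.RS f t) (WCR.rho f t w) := hg.rot (WCR.fin_rot _)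
  exact ⟨hg'.cyc, WCR.fin_spec hg, hg'.wcr hf hf1⟩
end

section
/- Suppose in addition that f and t are computable. Then the word problem of G is decidable: the predicate on F sending a word w to the truth value of mk(w) = 1 in G is a computable predicate. -/
namespace WP

abbrev FX := FreeGroup (Fin 46)

/-- The relator attached to the data `AB`, `W`. -/
def rel (AB : ℕ × Bool → FX) (W : ℕ → FX) (i : ℕ) : FX :=
  AB (i, false) * W i * (AB (i, true))⁻¹ * (W i)⁻¹

/-- Products of at most `n` conjugates of the relators, with parameters bounded by `M`. -/
inductive NC (R : ℕ → FX) (M : ℕ) : ℕ → FX → Prop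
  | one : NC R M 0 1
  | skip (n : ℕ) (x : FX) : NC R M n x → NC R M (n + 1) x
  | mul (n : ℕ) (x u : FX) (i : ℕ) (s : Bool) : NC R M n x → u.norm ≤ M → i + 1 ≤ M →
      NC R M (n + 1) (u * cond s (R i) (R i)⁻¹ * u⁻¹ * x)

theorem NC.mono_n {R M n m x} (h : NC R M n x) (hm : n ≤ m) : NC R M m x := by
  induction hm with
  | refl => exact h
  | step _ ih => exact NC.skip _ _ ih

theorem NC.mono_M {R M M' n x} (h : NC R M n x) (hm : M ≤ M') : NC R M' n x := by
  induction h with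
  | one => exact NC.one
  | skip n x _ ih => exact NC.skip _ _ ih
  | mul n x u i s _ h1 h2 ih => exact NC.mul _ _ _ _ _ ih (h1.trans hm) (h2.trans hm)

theorem NC.one' {R M n} : NC R M n 1 := NC.mono_n NC.one (Nat.zero_le n)

theorem NC.prod {R M m n x y} (h : NC R M m x) (h' : NC R M n y) : NC R M (m + n) (x * y) := by
  induction h with
  | one => simpa using h'
  | skip k x _ ih => exact (NC.skip _ _ ih).mono_n (by omega)
  | mul k x u i s _ h1 h2 ih =>
    have := NC.mul _ _ u i s ih h1 h2
    rw [← mul_assoc] at this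
    exact this.mono_n (by omega)

theorem NC.conj {R M n x} (h : NC R M n x) (v : FX) {M' : ℕ} (hv : v.norm + M ≤ M') :
    NC R M' n (v * x * v⁻¹) := by
  induction h with
  | one => simpa using NC.one
  | skip k x _ ih => exact NC.skip _ _ ih
  | mul k x u i s _ h1 h2 ih =>
    have := NC.mul _ _ (v * u) i s ih ((FreeGroup.norm_mul_le _ _).trans (by omega))
      (h2.trans (by omega))
    convert this using 1
    group

theorem NC.single {R M} (u : FX) (i : ℕ) (s : Bool) (h : u.norm ≤ M) (hi : i + 1 ≤ M) :
    NC R M 1 (u * cond s (R i) (R i)⁻¹ * u⁻¹) := by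
  simpa using NC.mul _ _ u i s (NC.one (R := R)) h hi

/-- conjugated letters: `(p, i, b, s)`. -/
abbrev CL := (FX × ℕ × Bool) × Bool

abbrev KS := FX × ℕ

def key (W : ℕ → FX) (x : FX × ℕ × Bool) : KS :=
  (cond x.2.2 (x.1 * (W x.2.1)⁻¹) x.1, x.2.1)

def cval (AB : ℕ × Bool → FX) (x : CL) : FX :=
  x.1.1 * cond x.2 (AB x.1.2) (AB x.1.2)⁻¹ * x.1.1⁻¹

def cprod (AB : ℕ × Bool → FX) (l : List CL) : FX := (l.map (cval AB)).prod

def kword (W : ℕ → FX) (l : List CL) : List (KS × Bool) := l.map fun x => (key W x.1, x.2)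

def csz (wt : ℕ → ℕ) (l : List CL) : ℕ := (l.map fun x => wt x.1.2.1).sum

def psz (wt : ℕ → ℕ) (l : List ((ℕ × Bool) × Bool)) : ℕ := (l.map fun x => wt x.1.1).sum

theorem norm_cond (x : FX) (s : Bool) : (cond s x x⁻¹).norm = x.norm := by
  cases s <;> simp

theorem norm_cval (AB : ℕ × Bool → FX) (wt : ℕ → ℕ) (hAB : ∀ z, (AB z).norm ≤ wt z.1)
    (K : ℕ) (x : CL) (hx : x.1.1.norm ≤ K) : (cval AB x).norm ≤ 2 * K + wt x.1.2.1 := by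
  unfold cval
  have h1 := FreeGroup.norm_mul_le (x.1.1 * cond x.2 (AB x.1.2) (AB x.1.2)⁻¹) x.1.1⁻¹
  have h2 := FreeGroup.norm_mul_le (x.1.1) (cond x.2 (AB x.1.2) (AB x.1.2)⁻¹)
  rw [norm_cond] at h2
  rw [FreeGroup.norm_inv_eq] at h1
  have := hAB x.1.2
  omega

theorem norm_cprod (AB : ℕ × Bool → FX) (wt : ℕ → ℕ) (hAB : ∀ z, (AB z).norm ≤ wt z.1)
    (K : ℕ) (l : List CL) (hl : ∀ x ∈ l, x.1.1.norm ≤ K) :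
    (cprod AB l).norm ≤ l.length * (2 * K) + csz wt l := by
  induction l with
  | nil => simp [cprod]
  | cons x l ih =>
    have h1 := norm_cval AB wt hAB K x (hl x (by simp))
    have h2 := ih fun y hy => hl y (by simp [hy])
    have h3 := FreeGroup.norm_mul_le (cval AB x) (cprod AB l)
    have e : cprod AB (x :: l) = cval AB x * cprod AB l := by simp [cprod]
    have e' : csz wt (x :: l) = wt x.1.2.1 + csz wt l := by simp [csz]
    rw [e, e', List.length_cons, Nat.succ_mul]
    omega

/-- two letters with the same key and sign have the same value up to one relator. -/
theorem key_eq (AB : ℕ × Bool → FX) (W : ℕ → FX) (wt : ℕ → ℕ)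
    (hAB : ∀ z, (AB z).norm ≤ wt z.1) (hW : ∀ i, i + 1 ≤ (W i).norm)
    (K M : ℕ) (x y : FX × ℕ × Bool) (s : Bool) (hx : x.1.norm ≤ K) (hy : y.1.norm ≤ K)
    (hM : 2 * K + wt x.2.1 ≤ M) (hk : key W x = key W y) :
    NC (rel AB W) M 1 (cval AB (x, s) * (cval AB (y, s))⁻¹) := by
  obtain ⟨p, i, b⟩ := x
  obtain ⟨q, j, b'⟩ := y
  simp only [key, Prod.mk.injEq] at hk
  obtain ⟨h1, rfl⟩ := hk
  have hA := hAB (i, false)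
  simp only at hA hM hx hy
  have nn : ∀ p : FX, p.norm ≤ K → ∀ s : Bool,
      (p * (AB (i, false))⁻¹).norm ≤ M := by
    intro p hp s
    refine (FreeGroup.norm_mul_le _ _).trans ?_
    rw [FreeGroup.norm_inv_eq]; omega
  have hi : ∀ p q : FX, p.norm ≤ K → q.norm ≤ K → q = p * W i → i + 1 ≤ M := by
    intro p q hp hq h
    have e : W i = p⁻¹ * q := by rw [h]; group
    have h3 := hW i
    have h4 := FreeGroup.norm_mul_le p⁻¹ q
    rw [← e, FreeGroup.norm_inv_eq] at h4
    omega
  cases b <;> cases b' <;> simp only [cond_true, cond_false] at h1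
  · subst h1; simpa using NC.one'
  · have h2 : q = p * W i := by rw [h1]; group
    have h3 := hi p q hx hy h2
    subst h2
    cases s
    · convert NC.single (R := rel AB W) (p * (AB (i, false))⁻¹) i false (nn p hx true) h3 using 1
      simp only [cval, rel, cond_false]; group
    · convert NC.single (R := rel AB W) p i true (by omega) h3 using 1
      simp only [cval, rel, cond_true]; group
  · have h2 : p = q * W i := by rw [← h1]; group
    have h3 := hi q p hy hx h2
    subst h2
    cases s
    · convert NC.single (R := rel AB W) (q * (AB (i, false))⁻¹) i true (nn q hy true) h3 using 1
      simp only [cval, rel, cond_true, cond_false]; group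
    · convert NC.single (R := rel AB W) q i false (by omega) h3 using 1
      simp only [cval, rel, cond_true, cond_false]; group
  · have h2 : p = q := by simpa using h1
    subst h2; simpa using NC.one'

/-- the key of a base letter. -/
def key1 (W : ℕ → FX) (z : ℕ × Bool) : KS := key W (1, z)

theorem key1_injective (W : ℕ → FX) (hW : ∀ i, i + 1 ≤ (W i).norm) :
    Function.Injective (key1 W) := by
  rintro ⟨i, b⟩ ⟨j, c⟩ h
  simp only [key1, key, Prod.mk.injEq] at h
  obtain ⟨h1, rfl⟩ := h
  have h0 : W i ≠ 1 := by
    intro h; have := hW i; rw [h] at this; simp at this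
  cases b <;> cases c <;> simp_all

theorem final_conv (AB : ℕ × Bool → FX) (W : ℕ → FX) (wt : ℕ → ℕ)
    (hAB : ∀ z, (AB z).norm ≤ wt z.1) (hW : ∀ i, i + 1 ≤ (W i).norm)
    (K M : ℕ) (l : List CL) (hl : ∀ x ∈ l, x.1.1.norm ≤ K)
    (hk : ∀ x ∈ l, key W x.1 ∈ Set.range (key1 W))
    (hM : 2 * K + l.length * (2 * K) + csz wt l ≤ M) :
    ∃ π : List ((ℕ × Bool) × Bool), psz wt π ≤ csz wt l ∧
      FreeGroup.map (key1 W) (FreeGroup.mk π) = FreeGroup.mk (kword W l) ∧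
      NC (rel AB W) M l.length (cprod AB l * (FreeGroup.lift AB (FreeGroup.mk π))⁻¹) := by
  induction l generalizing M with
  | nil => exact ⟨[], by simp [psz, csz], by simp [kword], by simpa [cprod] using NC.one'⟩
  | cons x l ih =>
    have e : cprod AB (x :: l) = cval AB x * cprod AB l := by simp [cprod]
    have e' : csz wt (x :: l) = wt x.1.2.1 + csz wt l := by simp [csz]
    have hx := hl x (by simp)
    have hv := norm_cval AB wt hAB K x hx
    rw [e', List.length_cons, Nat.add_one_mul l.length] at hM
    obtain ⟨π, h1, h2, h3⟩ := ih (2 * K + l.length * (2 * K) + csz wt l)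
      (fun y hy => hl y (by simp [hy]))
      (fun y hy => hk y (by simp [hy])) le_rfl
    obtain ⟨⟨i, b⟩, hz⟩ := hk x (by simp)
    have hi : i = x.1.2.1 := by
      have := congrArg Prod.snd hz
      simpa [key1, key] using this
    refine ⟨((i, b), x.2) :: π, ?_, ?_, ?_⟩
    · rw [e']; simp only [psz, List.map_cons, List.sum_cons, hi] at h1 ⊢; omega
    · rw [FreeGroup.map.mk] at h2 ⊢
      have : ∀ (a : KS × Bool) L, FreeGroup.mk (a :: L) = FreeGroup.mk [a] * FreeGroup.mk L := by
        intro a L; rw [FreeGroup.mul_mk]; rfl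
      rw [List.map_cons, this, h2]
      simp only [hz]
      exact (this _ _).symm
    · have h4 := key_eq AB W wt hAB hW K M x.1 (1, i, b) x.2 hx (by simp)
        (by omega) hz.symm
      have e4 : cval AB ((1, i, b), x.2) = FreeGroup.lift AB (FreeGroup.mk [((i, b), x.2)]) := by
        simp [cval]
      have e5 : FreeGroup.lift AB (FreeGroup.mk (((i, b), x.2) :: π)) =
          cval AB ((1, i, b), x.2) * FreeGroup.lift AB (FreeGroup.mk π) := by
        rw [e4, ← map_mul, FreeGroup.mul_mk]; rfl
      have h5 := (h3.conj (M' := M) (cval AB x) (by omega)).prod h4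
      rw [e, e5, List.length_cons]
      convert h5 using 1
      group

theorem not_isReduced_split {α : Type*} (g : α → KS × Bool) (l : List α)
    (h : ¬ FreeGroup.IsReduced (l.map g)) :
    ∃ l₁ x y l₂, l = l₁ ++ x :: y :: l₂ ∧ (g x).1 = (g y).1 ∧ (g x).2 = !(g y).2 := by
  induction l with
  | nil => exact absurd FreeGroup.IsReduced.nil h
  | cons x l ih =>
    cases l with
    | nil => exact absurd FreeGroup.IsReduced.singleton h
    | cons y l =>
      by_cases h1 : (g x).1 = (g y).1 → (g x).2 = (g y).2
      · have : ¬ FreeGroup.IsReduced ((y :: l).map g) := by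
          intro h2
          apply h
          simp only [List.map_cons] at h2 ⊢
          exact FreeGroup.isReduced_cons_cons.2 ⟨h1, h2⟩
        obtain ⟨l₁, a, b, l₂, e, h3⟩ := ih this
        exact ⟨x :: l₁, a, b, l₂, by rw [e]; rfl, h3⟩
      · push Not at h1
        refine ⟨[], x, y, l, rfl, h1.1, ?_⟩
        have := h1.2
        revert this
        cases (g x).2 <;> cases (g y).2 <;> simp

theorem reduction (AB : ℕ × Bool → FX) (W : ℕ → FX) (wt : ℕ → ℕ)
    (hAB : ∀ z, (AB z).norm ≤ wt z.1) (hW : ∀ i, i + 1 ≤ (W i).norm)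
    (K M : ℕ) (n : ℕ) : ∀ (l : List CL), l.length ≤ n → (∀ x ∈ l, x.1.1.norm ≤ K) →
    FreeGroup.mk (kword W l) ∈ Set.range (FreeGroup.map (key1 W)) →
    2 * K + l.length * (2 * K) + csz wt l ≤ M →
    ∃ π : List ((ℕ × Bool) × Bool), psz wt π ≤ csz wt l ∧
      FreeGroup.map (key1 W) (FreeGroup.mk π) = FreeGroup.mk (kword W l) ∧
      NC (rel AB W) M l.length (cprod AB l * (FreeGroup.lift AB (FreeGroup.mk π))⁻¹) := by
  classical
  induction n with
  | zero =>
    intro l hl h1 _ h3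
    obtain rfl : l = [] := by simpa using hl
    exact final_conv AB W wt hAB hW K M [] (by simp) (by simp) h3
  | succ n ih =>
    intro l hl h1 h2 h3
    by_cases hr : FreeGroup.IsReduced (kword W l)
    · refine final_conv AB W wt hAB hW K M l h1 ?_ h3
      obtain ⟨π0, hπ⟩ := h2
      have hr' : FreeGroup.IsReduced (π0.toWord.map fun z => (key1 W z.1, z.2)) := by
        have := FreeGroup.isReduced_toWord (x := π0)
        unfold FreeGroup.IsReduced at this ⊢
        rw [List.isChain_map]
        refine this.imp ?_
        intro a b hab h
        exact hab (key1_injective W hW h)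
      have e1 : FreeGroup.mk (π0.toWord.map fun z => (key1 W z.1, z.2)) =
          FreeGroup.mk (kword W l) := by
        rw [← hπ]
        conv_rhs => rw [← FreeGroup.mk_toWord (x := π0), FreeGroup.map.mk]
      have e2 := congrArg FreeGroup.toWord e1
      rw [FreeGroup.toWord_mk, FreeGroup.toWord_mk, hr'.reduce_eq, hr.reduce_eq] at e2
      intro x hx
      have : (key W x.1, x.2) ∈ kword W l := List.mem_map.2 ⟨x, hx, rfl⟩
      rw [← e2] at this
      obtain ⟨z, _, hz⟩ := List.mem_map.1 this
      exact ⟨z.1, congrArg Prod.fst hz⟩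
    · obtain ⟨l₁, x, y, l₂, rfl, hk, hs⟩ := not_isReduced_split _ l hr
      simp only at hk hs
      have hx := h1 x (by simp)
      have hy := h1 y (by simp)
      have e' : csz wt (l₁ ++ x :: y :: l₂) =
          csz wt (l₁ ++ l₂) + wt x.1.2.1 + wt y.1.2.1 := by simp [csz]; omega
      have e'' : csz wt (l₁ ++ l₂) = csz wt l₁ + csz wt l₂ := by simp [csz]
      have ek : FreeGroup.mk (kword W (l₁ ++ x :: y :: l₂)) =
          FreeGroup.mk (kword W (l₁ ++ l₂)) := by
        simp only [kword, List.map_append, List.map_cons, hk, hs]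
        exact Quot.sound (by simp)
      have el : (l₁ ++ x :: y :: l₂).length = (l₁ ++ l₂).length + 1 + 1 := by simp; omega
      have el' : (l₁ ++ l₂).length = l₁.length + l₂.length := by simp
      rw [e', el, Nat.add_one_mul ((l₁ ++ l₂).length + 1), Nat.add_one_mul (l₁ ++ l₂).length] at h3
      rw [ek] at h2 ⊢
      obtain ⟨π, p1, p2, p3⟩ := ih (l₁ ++ l₂) (by omega)
        (fun z hz => h1 z (by simp at hz ⊢; tauto)) h2 (by omega)
      refine ⟨π, by omega, p2, ?_⟩
      have h4 := key_eq AB W wt hAB hW K (2 * K + wt x.1.2.1) x.1 y.1 x.2 hx hy le_rfl hk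
      have e4 : (cval AB (y.1, x.2))⁻¹ = cval AB y := by
        simp only [cval, hs]; cases y.2 <;> simp [mul_assoc]
      have n1 := norm_cprod AB wt hAB K l₁ (fun z hz => h1 z (by simp [hz]))
      rw [el', Nat.add_mul l₁.length] at h3
      have h5 := (h4.conj (M' := M) (cprod AB l₁) (by omega)).prod p3
      rw [el]
      refine NC.mono_n (n := 1 + (l₁ ++ l₂).length) ?_ (by omega)
      convert h5 using 1
      rw [e4]
      simp only [cprod, List.map_append, List.map_cons, List.prod_append, List.prod_cons]
      group

end WP
namespace WP

/-- translation action on the free group on `KS`. -/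
def act : FX →* MulAut (FreeGroup KS) where
  toFun h := FreeGroup.freeGroupCongr ((Equiv.mulLeft h).prodCongr (Equiv.refl ℕ))
  map_one' := by
    apply MulEquiv.toMonoidHom_injective
    apply FreeGroup.ext_hom
    rintro ⟨p, i⟩
    simp [FreeGroup.freeGroupCongr]
  map_mul' a b := by
    apply MulEquiv.toMonoidHom_injective
    apply FreeGroup.ext_hom
    rintro ⟨p, i⟩
    simp [FreeGroup.freeGroupCongr, mul_assoc]

theorem act_of (h p : FX) (i : ℕ) :
    act h (FreeGroup.of (p, i)) = FreeGroup.of (h * p, i) := by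
  simp [act, FreeGroup.freeGroupCongr]

abbrev QG := FreeGroup KS ⋊[act] FX

abbrev EL := Fin 46 ⊕ (ℕ × Bool)

def sig (AB : ℕ × Bool → FX) : FreeGroup EL →* FX :=
  FreeGroup.lift (Sum.elim FreeGroup.of AB)

def tau (W : ℕ → FX) : FreeGroup EL →* QG :=
  FreeGroup.lift (Sum.elim (fun x => SemidirectProduct.inr (FreeGroup.of x))
    (fun z => SemidirectProduct.inl (FreeGroup.of (key1 W z))))

def conv : FX → List (EL × Bool) → List CL × FX
  | p, [] => ([], p)
  | p, (Sum.inl x, s) :: e => conv (p * FreeGroup.mk [(x, s)]) e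
  | p, (Sum.inr z, s) :: e => (((p, z), s) :: (conv p e).1, (conv p e).2)

theorem mk_cons {α : Type*} (a : α × Bool) (L : List (α × Bool)) :
    FreeGroup.mk (a :: L) = FreeGroup.mk [a] * FreeGroup.mk L := by
  rw [FreeGroup.mul_mk]; rfl

theorem mk_single {α : Type*} (a : α) (s : Bool) :
    FreeGroup.mk [(a, s)] = cond s (FreeGroup.of a) (FreeGroup.of a)⁻¹ := by
  cases s
  · simp [FreeGroup.of, FreeGroup.inv_mk, FreeGroup.invRev]
  · rfl

theorem conv_sig (AB : ℕ × Bool → FX) (e : List (EL × Bool)) : ∀ p : FX,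
    p * sig AB (FreeGroup.mk e) = cprod AB (conv p e).1 * (conv p e).2 := by
  induction e with
  | nil => intro p; simp [conv, cprod, ← FreeGroup.one_eq_mk]
  | cons a e ih =>
    intro p
    rw [mk_cons, map_mul]
    obtain ⟨x | z, s⟩ := a
    · simp only [conv]
      rw [← ih, ← mul_assoc]
      congr 2
      simp only [mk_single]
      cases s <;> simp [sig]
    · simp only [conv]
      have e1 : ∀ a l, cprod AB (a :: l) = cval AB a * cprod AB l := by simp [cprod]
      rw [e1, mul_assoc, ← ih]
      simp only [mk_single, cval]
      cases s <;> simp [sig, mul_assoc]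

theorem inl_key (W : ℕ → FX) (p : FX) (z : ℕ × Bool) :
    (SemidirectProduct.inl (FreeGroup.of (key W (p, z))) : QG) =
      SemidirectProduct.inr p * SemidirectProduct.inl (FreeGroup.of (key1 W z)) *
        (SemidirectProduct.inr p)⁻¹ := by
  rw [← map_inv, ← SemidirectProduct.inl_aut]
  have : key1 W z = (cond z.2 (W z.1)⁻¹ 1, z.1) := by
    simp [key1, key]
  rw [this, act_of]
  congr 2
  simp only [key]
  cases z.2 <;> simp

theorem conv_tau (W : ℕ → FX) (e : List (EL × Bool)) : ∀ p : FX,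
    SemidirectProduct.inr p * tau W (FreeGroup.mk e) =
      SemidirectProduct.inl (FreeGroup.mk (kword W (conv p e).1)) *
        SemidirectProduct.inr (conv p e).2 := by
  induction e with
  | nil => intro p; simp [conv, kword, ← FreeGroup.one_eq_mk]
  | cons a e ih =>
    intro p
    rw [mk_cons, map_mul]
    obtain ⟨x | z, s⟩ := a
    · simp only [conv]
      rw [← ih, ← mul_assoc, map_mul]
      congr 2
      simp only [mk_single]
      cases s <;> simp [tau]
    · simp only [conv]
      have e1 : ∀ a l, kword W (a :: l) = (key W a.1, a.2) :: kword W l := by simp [kword]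
      rw [e1, mk_cons _ (kword W _), map_mul SemidirectProduct.inl,
        mul_assoc (SemidirectProduct.inl _), ← ih]
      simp only [mk_single]
      have := inl_key W p z
      cases s
      · simp only [cond_false, map_inv, this]
        simp [tau, mul_assoc]
      · simp only [cond_true, this]
        simp [tau, mul_assoc]

def ewt (wt : ℕ → ℕ) (x : EL × Bool) : ℕ := Sum.elim (fun _ => 1) (fun z => wt z.1) x.1

def esz (wt : ℕ → ℕ) (e : List (EL × Bool)) : ℕ := (e.map (ewt wt)).sum

theorem esz_append (wt : ℕ → ℕ) (e e' : List (EL × Bool)) :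
    esz wt (e ++ e') = esz wt e + esz wt e' := by simp [esz]

theorem conv_bound (wt : ℕ → ℕ) (hwt : ∀ i, 1 ≤ wt i) (e : List (EL × Bool)) : ∀ p : FX,
    (conv p e).1.length ≤ esz wt e ∧ csz wt (conv p e).1 ≤ esz wt e ∧
      ∀ x ∈ (conv p e).1, x.1.1.norm ≤ p.norm + esz wt e := by
  induction e with
  | nil => intro p; simp [conv, csz]
  | cons a e ih =>
    intro p
    have e1 : esz wt (a :: e) = ewt wt a + esz wt e := by simp [esz]
    obtain ⟨x | z, s⟩ := a
    · simp only [conv]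
      obtain ⟨h1, h2, h3⟩ := ih (p * FreeGroup.mk [(x, s)])
      have h4 := FreeGroup.norm_mul_le p (FreeGroup.mk [(x, s)])
      have h5 : (FreeGroup.mk [(x, s)]).norm ≤ 1 := FreeGroup.norm_mk_le
      simp only [e1, ewt, Sum.elim_inl]
      refine ⟨by omega, by omega, fun y hy => ?_⟩
      have := h3 y hy
      omega
    · simp only [conv]
      obtain ⟨h1, h2, h3⟩ := ih p
      have := hwt z.1
      simp only [e1, ewt, Sum.elim_inr]
      refine ⟨by simp; omega, by simp [csz] at h2 ⊢; omega, fun y hy => ?_⟩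
      rcases List.mem_cons.1 hy with rfl | hy
      · simp only; omega
      · have := h3 y hy
        omega

theorem norm_lift_psz (AB : ℕ × Bool → FX) (wt : ℕ → ℕ) (hAB : ∀ z, (AB z).norm ≤ wt z.1)
    (π : List ((ℕ × Bool) × Bool)) :
    (FreeGroup.lift AB (FreeGroup.mk π)).norm ≤ psz wt π := by
  induction π with
  | nil => simp [psz, ← FreeGroup.one_eq_mk]
  | cons a π ih =>
    rw [mk_cons, map_mul]
    refine (FreeGroup.norm_mul_le _ _).trans ?_
    have e1 : psz wt (a :: π) = wt a.1.1 + psz wt π := by simp [psz]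
    have e2 : (FreeGroup.lift AB (FreeGroup.mk [a])).norm = (AB a.1).norm := by
      obtain ⟨z, s⟩ := a
      rw [mk_single]
      cases s <;> simp
    have := hAB a.1
    omega

theorem norm_sig_esz (AB : ℕ × Bool → FX) (wt : ℕ → ℕ) (hAB : ∀ z, (AB z).norm ≤ wt z.1)
    (e : List (EL × Bool)) :
    (sig AB (FreeGroup.mk e)).norm ≤ esz wt e := by
  induction e with
  | nil => simp [esz, ← FreeGroup.one_eq_mk]
  | cons a e ih =>
    rw [mk_cons, map_mul]
    refine (FreeGroup.norm_mul_le _ _).trans ?_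
    have e1 : esz wt (a :: e) = ewt wt a + esz wt e := by simp [esz]
    have e2 : (sig AB (FreeGroup.mk [a])).norm ≤ ewt wt a := by
      obtain ⟨x | z, s⟩ := a
      · rw [mk_single]
        cases s <;> simp [sig, ewt]
      · rw [mk_single]
        have := hAB z
        cases s <;> simpa [sig, ewt] using this
    omega

/-- the base group in the second factor -/
def phiQ (W : ℕ → FX) : FreeGroup (ℕ × Bool) →* QG :=
  SemidirectProduct.inl.comp (FreeGroup.map (key1 W))

theorem lemmaQ (AB : ℕ × Bool → FX) (W : ℕ → FX) (wt : ℕ → ℕ) (hwt : ∀ i, 1 ≤ wt i)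
    (hAB : ∀ z, (AB z).norm ≤ wt z.1) (hW : ∀ i, i + 1 ≤ (W i).norm)
    (L : ℕ) (e : List (EL × Bool)) (he : esz wt e ≤ L)
    (h : tau W (FreeGroup.mk e) ∈ (phiQ W).range) :
    ∃ g : FX, ∃ π, g = FreeGroup.lift AB π ∧ g.norm ≤ L ∧
      phiQ W π = tau W (FreeGroup.mk e) ∧
      NC (rel AB W) (3 * L + 2 * L * L) L (sig AB (FreeGroup.mk e) * g⁻¹) := by
  obtain ⟨π0, h0⟩ := h
  have h1 := conv_tau W e 1
  have h2 := conv_sig AB e 1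
  obtain ⟨h3, h4, h5⟩ := conv_bound wt hwt e 1
  rw [map_one, one_mul] at h1
  rw [one_mul] at h2
  have hr : (conv 1 e).2 = 1 := by
    have := congrArg SemidirectProduct.right h1
    rw [← h0] at this
    simpa [phiQ] using this.symm
  rw [hr, map_one, mul_one] at h1
  rw [hr, mul_one] at h2
  have hl : FreeGroup.map (key1 W) π0 = FreeGroup.mk (kword W (conv 1 e).1) := by
    apply SemidirectProduct.inl_injective (φ := act)
    rw [← h1, ← h0]; rfl
  have hb : 2 * L + (conv 1 e).1.length * (2 * L) + csz wt (conv 1 e).1 ≤ 3 * L + 2 * L * L := by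
    have : (conv 1 e).1.length * (2 * L) ≤ L * (2 * L) := Nat.mul_le_mul_right _ (by omega)
    have e : L * (2 * L) = 2 * L * L := by ring
    omega
  obtain ⟨π, q1, q2, q3⟩ := reduction AB W wt hAB hW L (3 * L + 2 * L * L) _ (conv 1 e).1 le_rfl
    (fun x hx => by have := h5 x hx; simp at this; omega) ⟨π0, hl⟩ hb
  refine ⟨_, FreeGroup.mk π, rfl, ?_, ?_, ?_⟩
  · have := norm_lift_psz AB wt hAB π
    omega
  · rw [h1, ← q2]; rfl
  · rw [h2]
    exact q3.mono_n (by omega)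

end WP
namespace WP

/-- The two factors of the amalgam. -/
def Fam : Bool → Type
  | true => FX
  | false => QG

instance famGroup : ∀ b, Group (Fam b)
  | true => inferInstanceAs (Group FX)
  | false => inferInstanceAs (Group QG)

def phi (AB : ℕ × Bool → FX) (W : ℕ → FX) : ∀ b, FreeGroup (ℕ × Bool) →* Fam b
  | true => FreeGroup.lift AB
  | false => phiQ W

abbrev Am (AB : ℕ × Bool → FX) (W : ℕ → FX) := Monoid.PushoutI (phi AB W)

/-- syllables -/
abbrev Syl := FX ⊕ List (EL × Bool)

def syn (W : ℕ → FX) : Syl → (Σ b, Fam b)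
  | Sum.inl g => ⟨true, g⟩
  | Sum.inr e => ⟨false, tau W (FreeGroup.mk e)⟩

def val (AB : ℕ × Bool → FX) (W : ℕ → FX) (x : Syl) : Am AB W :=
  Monoid.PushoutI.of (syn W x).1 (syn W x).2

def sgv (AB : ℕ × Bool → FX) : Syl → FX
  | Sum.inl g => g
  | Sum.inr e => sig AB (FreeGroup.mk e)

def ssz (wt : ℕ → ℕ) : Syl → ℕ
  | Sum.inl g => g.norm
  | Sum.inr e => esz wt e

theorem merge_two (AB : ℕ × Bool → FX) (W : ℕ → FX) (wt : ℕ → ℕ) (x y : Syl)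
    (h : (syn W x).1 = (syn W y).1) : ∃ z : Syl, val AB W z = val AB W x * val AB W y ∧
      sgv AB z = sgv AB x * sgv AB y ∧ ssz wt z ≤ ssz wt x + ssz wt y := by
  rcases x with g | e <;> rcases y with g' | e'
  · exact ⟨Sum.inl (g * g'), map_mul (Monoid.PushoutI.of (φ := phi AB W) true) g g', rfl,
      FreeGroup.norm_mul_le _ _⟩
  · simp [syn] at h
  · simp [syn] at h
  · refine ⟨Sum.inr (e ++ e'), ?_, ?_, (esz_append wt e e').le⟩
    · have := map_mul (Monoid.PushoutI.of (φ := phi AB W) false) (tau W (FreeGroup.mk e))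
        (tau W (FreeGroup.mk e'))
      unfold val syn
      simp only
      rw [← FreeGroup.mul_mk, map_mul]
      exact this
    · simp only [sgv]
      rw [← FreeGroup.mul_mk, map_mul]

theorem merge_list (AB : ℕ × Bool → FX) (W : ℕ → FX) (wt : ℕ → ℕ) (L : ℕ) (l : List Syl)
    (hl : ∀ x ∈ l, ssz wt x ≤ L)
    (h : ¬ l.IsChain fun x y => (syn W x).1 ≠ (syn W y).1) : ∃ l' : List Syl,
      l'.length + 1 = l.length ∧ (∀ x ∈ l', ssz wt x ≤ 2 * L) ∧
      (l'.map (val AB W)).prod = (l.map (val AB W)).prod ∧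
      (l'.map (sgv AB)).prod = (l.map (sgv AB)).prod := by
  induction l with
  | nil => exact absurd List.isChain_nil h
  | cons x l ih =>
    cases l with
    | nil => exact absurd (List.isChain_singleton x) h
    | cons y l =>
      by_cases h1 : (syn W x).1 ≠ (syn W y).1
      · have h2 : ¬ (y :: l).IsChain fun x y => (syn W x).1 ≠ (syn W y).1 := by
          intro h2
          exact h (List.isChain_cons_cons.2 ⟨h1, h2⟩)
        obtain ⟨l', p1, p2, p3, p4⟩ := ih (fun z hz => hl z (List.mem_cons_of_mem _ hz)) h2
        refine ⟨x :: l', ?_, ?_, ?_, ?_⟩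
        · simp only [List.length_cons] at p1 ⊢; omega
        · intro z hz
          rcases List.mem_cons.1 hz with rfl | hz
          · have := hl z (by simp); omega
          · exact p2 z hz
        · rw [List.map_cons, List.prod_cons, p3]; simp
        · rw [List.map_cons, List.prod_cons, p4]; simp
      · push Not at h1
        obtain ⟨z, p1, p2, p3⟩ := merge_two AB W wt x y h1
        have hx := hl x (by simp)
        have hy := hl y (by simp)
        refine ⟨z :: l, by simp, ?_, ?_, ?_⟩
        · intro w hw
          rcases List.mem_cons.1 hw with rfl | hw
          · omega
          · have := hl w (by simp [hw]); omega
        · simp [p1, mul_assoc]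
        · simp [p2, mul_assoc]

theorem exists_mem_range (AB : ℕ × Bool → FX) (W : ℕ → FX)
    (hinj : ∀ b, Function.Injective (phi AB W b)) (l : List Syl) (hne : l ≠ [])
    (hc : l.IsChain fun x y => (syn W x).1 ≠ (syn W y).1)
    (h1 : (l.map (val AB W)).prod = 1) :
    ∃ x ∈ l, (syn W x).2 ∈ (phi AB W (syn W x).1).range := by
  by_contra hcon
  push Not at hcon
  let w : Monoid.CoprodI.Word Fam :=
    { toList := l.map (syn W)
      ne_one := by
        intro z hz
        obtain ⟨x, hx, rfl⟩ := List.mem_map.1 hz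
        intro h
        apply hcon x hx
        rw [h]
        exact one_mem _
      chain_ne := by
        rw [List.isChain_map]
        exact hc }
  have hw : Monoid.PushoutI.Reduced (phi AB W) w := by
    intro z hz
    obtain ⟨x, hx, rfl⟩ := List.mem_map.1 hz
    exact hcon x hx
  have hp : Monoid.PushoutI.ofCoprodI (φ := phi AB W) w.prod = 1 := by
    rw [← h1, Monoid.CoprodI.Word.prod, map_list_prod]
    simp only [w, List.map_map]
    congr 1
  have := hw.eq_empty_of_mem_range hinj (by rw [hp]; exact one_mem _)
  have h2 : w.toList = [] := by rw [this]; rfl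
  simp only [w, List.map_eq_nil_iff] at h2
  exact hne h2

theorem sig_norm_list (AB : ℕ × Bool → FX) (wt : ℕ → ℕ) (hAB : ∀ z, (AB z).norm ≤ wt z.1)
    (L : ℕ) (l : List Syl) (hl : ∀ x ∈ l, ssz wt x ≤ L) :
    ((l.map (sgv AB)).prod).norm ≤ l.length * L := by
  induction l with
  | nil => simp
  | cons x l ih =>
    rw [List.map_cons, List.prod_cons, List.length_cons, Nat.add_one_mul]
    refine (FreeGroup.norm_mul_le _ _).trans ?_
    have h1 := ih fun y hy => hl y (by simp [hy])
    have h2 := hl x (by simp)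
    have h3 : (sgv AB x).norm ≤ ssz wt x := by
      rcases x with g | e
      · exact le_rfl
      · exact norm_sig_esz AB wt hAB e
    omega

/-- change the type of a syllable lying in the base group -/
theorem flip_syl (AB : ℕ × Bool → FX) (W : ℕ → FX) (wt : ℕ → ℕ) (hwt : ∀ i, 1 ≤ wt i)
    (hAB : ∀ z, (AB z).norm ≤ wt z.1) (hW : ∀ i, i + 1 ≤ (W i).norm)
    (pb : ℕ → ℕ) (hpb : Monotone pb)
    (hP : ∀ π : FreeGroup (ℕ × Bool), psz wt π.toWord ≤ pb (FreeGroup.lift AB π).norm)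
    (L : ℕ) (x : Syl) (hx : ssz wt x ≤ L)
    (h : (syn W x).2 ∈ (phi AB W (syn W x).1).range) :
    ∃ y : Syl, (syn W y).1 ≠ (syn W x).1 ∧ val AB W y = val AB W x ∧ ssz wt y ≤ pb L + L ∧
      NC (rel AB W) (3 * L + 2 * L * L) L (sgv AB x * (sgv AB y)⁻¹) ∧
      ((syn W y).2 = 1 → sgv AB y = 1) := by
  rcases x with g | e
  · obtain ⟨π, hπ⟩ := h
    have hπ' : FreeGroup.lift AB π = g := hπ
    have e1 : ∀ l : List ((ℕ × Bool) × Bool),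
        FreeGroup.mk (l.map fun z => ((Sum.inr z.1 : EL), z.2)) =
          FreeGroup.map Sum.inr (FreeGroup.mk l) := by
      intro l; rw [FreeGroup.map.mk]
    have e2 : tau W (FreeGroup.map Sum.inr π) = phiQ W π := by
      rw [← MonoidHom.comp_apply]
      congr 1
      apply FreeGroup.ext_hom
      intro z
      simp [tau, phiQ]
    have e4 : sgv AB (Sum.inr (π.toWord.map fun z => (Sum.inr z.1, z.2))) = g := by
      simp only [sgv]
      rw [e1, FreeGroup.mk_toWord, ← hπ', ← MonoidHom.comp_apply]
      congr 1
      apply FreeGroup.ext_hom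
      intro z
      simp [sig]
    refine ⟨Sum.inr (π.toWord.map fun z => (Sum.inr z.1, z.2)), by simp [syn], ?_, ?_, ?_, ?_⟩
    · unfold val syn
      simp only
      rw [e1, FreeGroup.mk_toWord]
      have e2 : tau W (FreeGroup.map Sum.inr π) = phi AB W false π := by
        exact e2
      have e3 : g = phi AB W true π := hπ.symm
      rw [e2, e3, Monoid.PushoutI.of_apply_eq_base, Monoid.PushoutI.of_apply_eq_base]
    · have h1 := hP π
      rw [hπ'] at h1
      have h2 : pb g.norm ≤ pb L := hpb hx
      have e3 : ssz wt (Sum.inr (π.toWord.map fun z => (Sum.inr z.1, z.2))) =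
          psz wt π.toWord := by
        simp [ssz, esz, psz, Function.comp_def, ewt]
      rw [e3]
      omega
    · rw [e4]
      simpa [sgv] using NC.one'
    · intro h1
      have h2 : tau W (FreeGroup.mk (π.toWord.map fun z => ((Sum.inr z.1 : EL), z.2))) = 1 := h1
      rw [e1, FreeGroup.mk_toWord, e2] at h2
      have h3 : Function.Injective (phiQ W) := SemidirectProduct.inl_injective.comp
        (FreeGroup.map_injective (key1_injective W hW))
      have h4 : π = 1 := h3 (by rw [h2, map_one])
      rw [e4, ← hπ', h4, map_one]
  · obtain ⟨g, π, h1, h2, h3, h4⟩ := lemmaQ AB W wt hwt hAB hW L e hx h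
    refine ⟨Sum.inl g, by simp [syn], ?_, ?_, h4, fun h => h⟩
    · have e2 : tau W (FreeGroup.mk e) = phi AB W false π := h3.symm
      have e3 : g = phi AB W true π := h1
      unfold val syn
      simp only
      rw [e2, e3, Monoid.PushoutI.of_apply_eq_base, Monoid.PushoutI.of_apply_eq_base]
    · simp only [ssz]; omega

theorem main_bound (AB : ℕ × Bool → FX) (W : ℕ → FX) (wt : ℕ → ℕ) (hwt : ∀ i, 1 ≤ wt i)
    (hAB : ∀ z, (AB z).norm ≤ wt z.1) (hW : ∀ i, i + 1 ≤ (W i).norm)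
    (pb : ℕ → ℕ) (hpb : Monotone pb)
    (hP : ∀ π : FreeGroup (ℕ × Bool), psz wt π.toWord ≤ pb (FreeGroup.lift AB π).norm)
    (hinj : Function.Injective (FreeGroup.lift AB))
    (M : ℕ) (n : ℕ) : ∀ (L : ℕ) (l : List Syl), l.length = n → n ≤ M →
      (∀ x ∈ l, ssz wt x ≤ L) → (fun L => 2 * (pb L + L))^[n] L ≤ M →
      (l.map (val AB W)).prod = 1 →
      NC (rel AB W) (3 * M + 3 * M * M) (n * M) (l.map (sgv AB)).prod := by
  have hinj' : ∀ b, Function.Injective (phi AB W b) := by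
    intro b
    cases b
    · exact SemidirectProduct.inl_injective.comp
        (FreeGroup.map_injective (key1_injective W hW))
    · exact hinj
  have hmono : Monotone (fun L => 2 * (pb L + L)) := by
    intro a b hab
    have := hpb hab
    simp only
    omega
  induction n with
  | zero =>
    intro L l hl _ _ _ _
    obtain rfl : l = [] := by simpa using hl
    simpa using NC.one'
  | succ n ih =>
    intro L l hl hn hs hM h1
    rw [Function.iterate_succ_apply] at hM
    have hLM : L ≤ M := by
      have : ∀ k a, a ≤ (fun L => 2 * (pb L + L))^[k] a := by
        intro k a
        exact Function.id_le_iterate_of_id_le (f := fun L => 2 * (pb L + L))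
          (fun x => by simp only [id]; omega) k a
      have := this n (2 * (pb L + L))
      omega
    by_cases hc : l.IsChain fun x y => (syn W x).1 ≠ (syn W y).1
    · have hne : l ≠ [] := by rintro rfl; simp at hl
      obtain ⟨x, hx, hxr⟩ := exists_mem_range AB W hinj' l hne hc h1
      obtain ⟨y, y1, y2, y3, y4, y5⟩ := flip_syl AB W wt hwt hAB hW pb hpb hP L x (hs x hx) hxr
      obtain ⟨u, v, rfl⟩ := List.append_of_mem hx
      have hvp : ((u ++ y :: v).map (val AB W)).prod = 1 := by
        rw [← h1]; simp [y2]
      have hu := sig_norm_list AB wt hAB L u (fun z hz => hs z (by simp [hz]))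
      have hul : u.length * L ≤ M * M := Nat.mul_le_mul (by simp at hl; omega) hLM
      have hLL : L * L ≤ M * M := Nat.mul_le_mul hLM hLM
      have e0 : 2 * L * L = 2 * (L * L) := by ring
      have e0' : 3 * M * M = 3 * (M * M) := by ring
      have step := y4.conj (M' := 3 * M + 3 * M * M) (u.map (sgv AB)).prod (by omega)
      have split : ((u ++ x :: v).map (sgv AB)).prod =
          ((u.map (sgv AB)).prod * (sgv AB x * (sgv AB y)⁻¹) * ((u.map (sgv AB)).prod)⁻¹) *
            ((u ++ y :: v).map (sgv AB)).prod := by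
        simp only [List.map_append, List.map_cons, List.prod_append, List.prod_cons]
        group
      have rest : NC (rel AB W) (3 * M + 3 * M * M) (n * M)
          ((u ++ y :: v).map (sgv AB)).prod := by
        by_cases huv : u = [] ∧ v = []
        · obtain ⟨rfl, rfl⟩ := huv
          have hy1 : val AB W y = 1 := by simpa using hvp
          have hs1 : (syn W y).2 = 1 := by
            apply Monoid.PushoutI.of_injective hinj' (syn W y).1
            rw [map_one]; exact hy1
          simpa [y5 hs1] using NC.one'
        · have hcn : ¬ (u ++ y :: v).IsChain fun x y => (syn W x).1 ≠ (syn W y).1 := by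
            intro hc'
            have key : ∀ p q r : Bool, p ≠ q → r ≠ q → r ≠ p → False := by decide
            rcases v with _ | ⟨z, v⟩
            · rcases List.eq_nil_or_concat u with rfl | ⟨u', z, rfl⟩
              · exact huv ⟨rfl, rfl⟩
              · simp only [List.concat_eq_append, List.append_assoc, List.singleton_append]
                  at hc hc'
                have h1 := (List.isChain_cons_cons.1 (List.isChain_append.1 hc).2.1).1
                have h2 := (List.isChain_cons_cons.1 (List.isChain_append.1 hc').2.1).1
                exact key _ _ _ y1 h1 h2
            · have h1 := (List.isChain_cons_cons.1 (List.isChain_append.1 hc).2.1).1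
              have h2 := (List.isChain_cons_cons.1 (List.isChain_append.1 hc').2.1).1
              exact key _ _ _ y1 h1.symm h2.symm
          obtain ⟨l', p1, p2, p3, p4⟩ := merge_list AB W wt (pb L + L) (u ++ y :: v) (by
            intro z hz
            simp only [List.mem_append, List.mem_cons] at hz
            rcases hz with hz | rfl | hz
            · have := hs z (by simp [hz]); omega
            · exact y3
            · have := hs z (by simp [hz]); omega) hcn
          rw [← p4]
          refine ih (2 * (pb L + L)) l' ?_ (by omega) p2 hM (by rw [p3]; exact hvp)
          simp at hl p1; omega
      rw [split]
      refine (step.prod rest).mono_n ?_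
      rw [Nat.add_one_mul]; omega
    · obtain ⟨l', p1, p2, p3, p4⟩ := merge_list AB W wt L l hs hc
      rw [← p4]
      refine (ih (2 * L) l' (by omega) (by omega) p2 ?_ (by rw [p3]; exact h1)).mono_n
        (Nat.mul_le_mul_right _ (by omega))
      refine le_trans ?_ hM
      exact hmono.iterate n (by omega)

end WP
namespace WP

abbrev FB := FreeGroup (ℕ × Bool)

/-- indexed basis letters -/
def EE (s : Bool) (k : ℤ) : FB := if 0 < k then FreeGroup.of (k.toNat, s) else 1

def downP : Equiv.Perm (FB × ℤ) where
  toFun z := (z.1, z.2 - 1)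
  invFun z := (z.1, z.2 + 1)
  left_inv z := by simp
  right_inv z := by simp

def upP (s : Bool) : Equiv.Perm (FB × ℤ) where
  toFun z := (EE s (z.2 + 1) * (EE s z.2)⁻¹ * z.1, z.2 + 1)
  invFun z := (EE s (z.2 - 1) * (EE s z.2)⁻¹ * z.1, z.2 - 1)
  left_inv z := by ext <;> simp <;> group
  right_inv z := by ext <;> simp <;> group

def genP (x : Fin 46) : Equiv.Perm (FB × ℤ) :=
  if x = 0 then downP else if x = 1 then upP false
  else if x = 20 then downP else if x = 21 then upP true else 1

theorem genP_eq_one (x : Fin 46) (h0 : x.val ≠ 0) (h1 : x.val ≠ 1) (h2 : x.val ≠ 20)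
    (h3 : x.val ≠ 21) : genP x = 1 := by
  unfold genP
  rw [if_neg, if_neg, if_neg, if_neg]
  · rintro rfl; exact h3 rfl
  · rintro rfl; exact h2 rfl
  · rintro rfl; exact h1 rfl
  · rintro rfl; exact h0 rfl

def perm : FX →* Equiv.Perm (FB × ℤ) := FreeGroup.lift genP

theorem downP_pow (j : ℕ) (u : FB) (k : ℤ) : (downP ^ j) (u, k) = (u, k - j) := by
  induction j generalizing k with
  | zero => simp
  | succ j ih =>
    rw [pow_succ, Equiv.Perm.mul_apply]
    change (downP ^ j) (u, k - 1) = _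
    rw [ih]; congr 1; push_cast; ring

theorem upP_pow (s : Bool) (j : ℕ) (u : FB) : (upP s ^ j) (u, 0) = (EE s j * u, (j : ℤ)) := by
  induction j with
  | zero => simp [EE]
  | succ j ih =>
    rw [pow_succ', Equiv.Perm.mul_apply, ih]
    change (EE s ((j : ℤ) + 1) * (EE s (j : ℤ))⁻¹ * (EE s (j : ℤ) * u), (j : ℤ) + 1) = _
    simp [mul_assoc]

theorem mk_genPow (x : Fin 46) (j : ℕ) :
    FreeGroup.mk (genPow x true j) = FreeGroup.of x ^ j := by
  unfold genPow
  induction j with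
  | zero => rfl
  | succ j ih => rw [List.replicate_succ, mk_cons, ih, pow_succ']; rfl

theorem mk_genPow_false (x : Fin 46) (j : ℕ) :
    FreeGroup.mk (genPow x false j) = (FreeGroup.of x ^ j)⁻¹ := by
  unfold genPow
  induction j with
  | zero => simp; rfl
  | succ j ih =>
    rw [List.replicate_succ, mk_cons, ih, pow_succ, mul_inv_rev, mk_single]; rfl

theorem mk_flatten {α : Type*} (L : List (List (α × Bool))) :
    FreeGroup.mk L.flatten = (L.map FreeGroup.mk).prod := by
  induction L with
  | nil => rfl
  | cons l L ih => rw [List.flatten_cons, ← FreeGroup.mul_mk, ih]; simp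

theorem mk_aWord (j : ℕ) : FreeGroup.mk (aWord j) =
    (List.ofFn fun k : Fin 20 => FreeGroup.of (genA k) ^ j).prod := by
  unfold aWord
  rw [mk_flatten, List.map_ofFn]
  simp only [Function.comp_def, mk_genPow]

theorem mk_bWord (j : ℕ) : FreeGroup.mk (bWord j) =
    (List.ofFn fun k : Fin 20 => FreeGroup.of (genB k) ^ j).prod := by
  unfold bWord
  rw [mk_flatten, List.map_ofFn]
  simp only [Function.comp_def, mk_genPow]

theorem mk_bWordRevInv (j : ℕ) : FreeGroup.mk (bWordRevInv j) = (FreeGroup.mk (bWord j))⁻¹ := by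
  rw [mk_bWord]
  unfold bWordRevInv
  rw [mk_flatten, List.map_ofFn, List.prod_inv_reverse]
  simp only [Function.comp_def, mk_genPow_false]
  congr 1

theorem mk_conjWordInv (i j : ℕ) :
    FreeGroup.mk (conjWordInv i j) = (FreeGroup.mk (conjWord i j))⁻¹ := by
  unfold conjWord conjWordInv
  simp only [← FreeGroup.mul_mk, mk_genPow, mk_genPow_false, mul_inv_rev, mul_assoc]

def ABf (f : ℕ → ℕ) (z : ℕ × Bool) : FX :=
  FreeGroup.mk (cond z.2 (bWord (f (z.1 + 1))) (aWord (f (z.1 + 1))))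

def Wf (t : ℕ → ℕ) (i : ℕ) : FX := FreeGroup.mk (conjWord (i + 1) (t (i + 1)))

theorem rel_eq (f t : ℕ → ℕ) (i : ℕ) :
    rel (ABf f) (Wf t) i = FreeGroup.mk (relatorWord f t (i + 1)) := by
  unfold rel relatorWord ABf Wf
  simp only [← FreeGroup.mul_mk, mk_bWordRevInv, mk_conjWordInv, cond_true, cond_false]

theorem norm_ABf (f : ℕ → ℕ) (z : ℕ × Bool) : (ABf f z).norm ≤ 20 * f (z.1 + 1) := by
  unfold ABf
  refine FreeGroup.norm_mk_le.trans ?_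
  rcases z with ⟨i, _ | _⟩ <;>
    simp [aWord, bWord, genPow, List.length_flatten, List.map_ofFn, Function.comp_def] <;> omega

/-- exponent of `c₁` -/
def cExp : FX →* Multiplicative ℤ :=
  FreeGroup.lift fun x => Multiplicative.ofAdd (if x = 40 then 1 else 0)

theorem cExp_mk (l : List (Fin 46 × Bool)) :
    |(cExp (FreeGroup.mk l)).toAdd| ≤ l.length := by
  induction l with
  | nil => simp [← FreeGroup.one_eq_mk]
  | cons x l ih =>
    rw [mk_cons, map_mul, toAdd_mul, List.length_cons]
    refine (abs_add_le _ _).trans ?_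
    have : |(cExp (FreeGroup.mk [x])).toAdd| ≤ 1 := by
      rw [mk_single]
      rcases x with ⟨x, _ | _⟩ <;> simp [cExp] <;> split_ifs <;> simp
    push_cast
    omega

theorem norm_Wf (t : ℕ → ℕ) (i : ℕ) : i + 1 ≤ (Wf t i).norm := by
  have h := cExp_mk (Wf t i).toWord
  rw [FreeGroup.mk_toWord] at h
  have e : (cExp (Wf t i)).toAdd = (i : ℤ) + 1 := by
    unfold Wf conjWord
    simp only [← FreeGroup.mul_mk, mk_genPow, map_mul, map_pow]
    simp [cExp, genC, genD, Fin.ext_iff]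
  rw [e] at h
  have : (Wf t i).norm = (Wf t i).toWord.length := rfl
  rw [this]
  have := le_abs_self ((i : ℤ) + 1)
  omega

theorem perm_ABf (f : ℕ → ℕ) (hf1 : ∀ i : ℕ, 1 ≤ i → 1 ≤ f i) (z : ℕ × Bool) (u : FB) :
    perm (ABf f z) (u, 0) = (FreeGroup.of (f (z.1 + 1), z.2) * u, 0) := by
  have hpos := hf1 (z.1 + 1) (by omega)
  unfold ABf perm
  rcases z with ⟨i, _ | _⟩
  · have h1 : ∀ k : Fin 18, genP (genA k.succ.succ) = 1 := by
      intro k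
      apply genP_eq_one <;> simp [genA] <;> omega
    simp only [cond_false, mk_aWord, map_list_prod, List.map_ofFn, Function.comp_def, map_pow,
      FreeGroup.lift_apply_of]
    rw [List.ofFn_succ, List.ofFn_succ]
    simp only [h1]
    simp only [one_pow, List.ofFn_const, List.prod_cons, List.prod_replicate, mul_one]
    have h2 : genP (genA 0) = downP := by simp [genP, genA]
    have h3 : genP (genA (Fin.succ 0)) = upP false := by simp [genP, genA, Fin.ext_iff]
    rw [h2, h3, Equiv.Perm.mul_apply, upP_pow, downP_pow]
    simp only at hpos
    simp [EE]; omega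
  · have h1 : ∀ k : Fin 18, genP (genB k.succ.succ) = 1 := by
      intro k
      apply genP_eq_one <;> simp [genB] <;> omega
    simp only [cond_true, mk_bWord, map_list_prod, List.map_ofFn, Function.comp_def, map_pow,
      FreeGroup.lift_apply_of]
    rw [List.ofFn_succ, List.ofFn_succ]
    simp only [h1]
    simp only [one_pow, List.ofFn_const, List.prod_cons, List.prod_replicate, mul_one]
    have h2 : genP (genB 0) = downP := by simp [genP, genB, Fin.ext_iff]
    have h3 : genP (genB (Fin.succ 0)) = upP true := by simp [genP, genB, Fin.ext_iff]
    rw [h2, h3, Equiv.Perm.mul_apply, upP_pow, downP_pow]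
    simp only at hpos
    simp [EE]; omega

def reidx (f : ℕ → ℕ) (z : ℕ × Bool) : ℕ × Bool := (f (z.1 + 1), z.2)

theorem reidx_injective (f : ℕ → ℕ) (hf : Function.Injective f) :
    Function.Injective (reidx f) := by
  rintro ⟨i, a⟩ ⟨j, b⟩ h
  simp only [reidx, Prod.mk.injEq] at h
  have := hf h.1
  exact Prod.ext (by simp only; omega) h.2

theorem perm_lift (f : ℕ → ℕ) (hf1 : ∀ i : ℕ, 1 ≤ i → 1 ≤ f i) (π : FB) : ∀ (u : FB),
    perm (FreeGroup.lift (ABf f) π) (u, 0) = (FreeGroup.map (reidx f) π * u, 0) := by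
  induction π using FreeGroup.induction_on with
  | C1 => intro u; simp
  | of z => intro u; simp only [FreeGroup.lift_apply_of, FreeGroup.map.of]; exact perm_ABf f hf1 z u
  | inv_of z _ =>
    intro u
    simp only [map_inv, FreeGroup.lift_apply_of, FreeGroup.map.of]
    rw [Equiv.Perm.inv_eq_iff_eq, perm_ABf f hf1]
    simp [reidx]
  | mul x y hx hy =>
    intro u
    rw [map_mul, map_mul, Equiv.Perm.mul_apply, hy, hx, map_mul, mul_assoc]

theorem lift_ABf_injective (f : ℕ → ℕ) (hf : Function.Injective f)
    (hf1 : ∀ i : ℕ, 1 ≤ i → 1 ≤ f i) : Function.Injective (FreeGroup.lift (ABf f)) := by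
  intro x y h
  apply FreeGroup.map_injective (reidx_injective f hf)
  have h1 := perm_lift f hf1 x 1
  have h2 := perm_lift f hf1 y 1
  rw [h, h2] at h1
  simpa using h1.symm

theorem EE_list (s : Bool) (k : ℤ) (n : ℕ) (hk : k ≤ n) : ∃ l : List ((ℕ × Bool) × Bool),
    FreeGroup.mk l = EE s k ∧ l.length ≤ 1 ∧ ∀ x ∈ l, x.1.1 ≤ n := by
  unfold EE
  split_ifs with h
  · exact ⟨[((k.toNat, s), true)], rfl, by simp, by simp; omega⟩
  · exact ⟨[], rfl, by simp, by simp⟩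

theorem EE_step (s : Bool) (k k' : ℤ) (n : ℕ) (hk : k ≤ n) (hk' : k' ≤ n)
    (l : List ((ℕ × Bool) × Bool)) (hl : ∀ x ∈ l, x.1.1 ≤ n) :
    ∃ l' : List ((ℕ × Bool) × Bool),
    FreeGroup.mk l' = EE s k * (EE s k')⁻¹ * FreeGroup.mk l ∧ l'.length ≤ l.length + 2 ∧
      ∀ x ∈ l', x.1.1 ≤ n := by
  obtain ⟨a, a1, a2, a3⟩ := EE_list s k n hk
  obtain ⟨b, b1, b2, b3⟩ := EE_list s k' n hk'
  refine ⟨a ++ FreeGroup.invRev b ++ l, ?_, ?_, ?_⟩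
  · rw [← FreeGroup.mul_mk, ← FreeGroup.mul_mk, ← FreeGroup.inv_mk, a1, b1]
  · simp; omega
  · intro x hx
    simp only [List.mem_append, FreeGroup.invRev, List.mem_reverse, List.mem_map] at hx
    rcases hx with (hx | ⟨y, hy, rfl⟩) | hx
    · exact a3 x hx
    · exact b3 y hy
    · exact hl x hx

theorem perm_word (w : List (Fin 46 × Bool)) : ∃ (l : List ((ℕ × Bool) × Bool)) (k : ℤ),
    perm (FreeGroup.mk w) (1, 0) = (FreeGroup.mk l, k) ∧ l.length ≤ 2 * w.length ∧
      |k| ≤ w.length ∧ ∀ x ∈ l, x.1.1 ≤ w.length := by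
  induction w with
  | nil => exact ⟨[], 0, by simp [← FreeGroup.one_eq_mk], by simp, by simp, by simp⟩
  | cons x w ih =>
    obtain ⟨l, k, h1, h2, h3, h4⟩ := ih
    rw [abs_le] at h3
    have h4' : ∀ x ∈ l, x.1.1 ≤ w.length + 1 := fun x hx => (h4 x hx).trans (Nat.le_succ _)
    have triv : ∃ (l' : List ((ℕ × Bool) × Bool)) (k' : ℤ),
        (FreeGroup.mk l, k) = (FreeGroup.mk l', k') ∧ l'.length ≤ 2 * (w.length + 1) ∧
        |k'| ≤ ((w.length + 1 : ℕ) : ℤ) ∧ ∀ x ∈ l', x.1.1 ≤ w.length + 1 :=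
      ⟨l, k, rfl, by omega, by rw [abs_le]; push_cast; omega, h4'⟩
    have down : ∀ s : Bool, ∃ (l' : List ((ℕ × Bool) × Bool)) (k' : ℤ),
        (cond s downP downP⁻¹) (FreeGroup.mk l, k) = (FreeGroup.mk l', k') ∧
        l'.length ≤ 2 * (w.length + 1) ∧
        |k'| ≤ ((w.length + 1 : ℕ) : ℤ) ∧ ∀ x ∈ l', x.1.1 ≤ w.length + 1 := by
      intro s
      cases s
      · exact ⟨l, k + 1, rfl, by omega, by rw [abs_le]; push_cast; omega, h4'⟩
      · exact ⟨l, k - 1, rfl, by omega, by rw [abs_le]; push_cast; omega, h4'⟩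
    have up : ∀ c s : Bool, ∃ (l' : List ((ℕ × Bool) × Bool)) (k' : ℤ),
        (cond s (upP c) (upP c)⁻¹) (FreeGroup.mk l, k) = (FreeGroup.mk l', k') ∧
        l'.length ≤ 2 * (w.length + 1) ∧
        |k'| ≤ ((w.length + 1 : ℕ) : ℤ) ∧ ∀ x ∈ l', x.1.1 ≤ w.length + 1 := by
      intro c s
      cases s
      · obtain ⟨l', p1, p2, p3⟩ := EE_step c (k - 1) k (w.length + 1) (by push_cast; omega)
          (by push_cast; omega) l h4'
        refine ⟨l', k - 1, ?_, by omega, by rw [abs_le]; push_cast; omega, p3⟩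
        rw [p1]; rfl
      · obtain ⟨l', p1, p2, p3⟩ := EE_step c (k + 1) k (w.length + 1) (by push_cast; omega)
          (by push_cast; omega) l h4'
        refine ⟨l', k + 1, ?_, by omega, by rw [abs_le]; push_cast; omega, p3⟩
        rw [p1]; rfl
    rw [mk_cons, map_mul, Equiv.Perm.mul_apply, h1, mk_single, List.length_cons]
    have e : perm (cond x.2 (FreeGroup.of x.1) (FreeGroup.of x.1)⁻¹) =
        cond x.2 (genP x.1) (genP x.1)⁻¹ := by
      rcases x with ⟨x, _ | _⟩ <;> simp [perm]
    rw [e]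
    unfold genP
    split_ifs
    · exact down x.2
    · exact up false x.2
    · exact down x.2
    · exact up true x.2
    · have : (cond x.2 (1 : Equiv.Perm (FB × ℤ)) 1⁻¹) = 1 := by cases x.2 <;> simp
      rw [this]
      exact triv

theorem toWord_map_inj (h : ℕ × Bool → ℕ × Bool) (hh : Function.Injective h) (π : FB) :
    (FreeGroup.map h π).toWord = π.toWord.map fun x => (h x.1, x.2) := by
  have h1 : FreeGroup.IsReduced (π.toWord.map fun x => (h x.1, x.2)) := by
    have := FreeGroup.isReduced_toWord (x := π)
    unfold FreeGroup.IsReduced at this ⊢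
    rw [List.isChain_map]
    refine this.imp ?_
    intro a b hab he
    exact hab (hh he)
  rw [← h1.reduce_eq, ← FreeGroup.toWord_mk]
  congr 1
  conv_lhs => rw [← FreeGroup.mk_toWord (x := π), FreeGroup.map.mk]

theorem psz_bound (f : ℕ → ℕ) (hf : Function.Injective f)
    (hf1 : ∀ i : ℕ, 1 ≤ i → 1 ≤ f i) (π : FB) :
    psz (fun i => 20 * f (i + 1)) π.toWord ≤
      40 * (FreeGroup.lift (ABf f) π).norm * (FreeGroup.lift (ABf f) π).norm := by
  set g := FreeGroup.lift (ABf f) π with hg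
  obtain ⟨l, k, h1, h2, h3, h4⟩ := perm_word g.toWord
  rw [FreeGroup.mk_toWord, hg, perm_lift f hf1, mul_one] at h1
  have h5 := (Prod.ext_iff.1 h1).1
  simp only at h5
  have h6 := toWord_map_inj (reidx f) (reidx_injective f hf) π
  rw [h5, FreeGroup.toWord_mk] at h6
  have h7 : (FreeGroup.reduce l).Sublist l := FreeGroup.Red.sublist FreeGroup.reduce.red
  have e : psz (fun i => 20 * f (i + 1)) π.toWord =
      ((FreeGroup.reduce l).map fun x => 20 * x.1.1).sum := by
    rw [h6]
    simp [psz, reidx, Function.comp_def]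
  rw [e]
  have h8 := List.sum_le_card_nsmul ((FreeGroup.reduce l).map fun x => 20 * x.1.1)
    (20 * g.norm) (by
      intro y hy
      obtain ⟨x, hx, rfl⟩ := List.mem_map.1 hy
      exact Nat.mul_le_mul_left _ (h4 x (h7.subset hx)))
  refine h8.trans ?_
  rw [List.length_map, smul_eq_mul]
  have h9 : (FreeGroup.reduce l).length ≤ 2 * g.norm := h7.length_le.trans h2
  calc _ ≤ (2 * g.norm) * (20 * g.norm) := Nat.mul_le_mul_right _ h9
    _ = _ := by ring

end WP
namespace WP

section
variable (AB : ℕ × Bool → FX) (W : ℕ → FX)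

def oT : FX →* Am AB W := Monoid.PushoutI.of (φ := phi AB W) true
def oF : QG →* Am AB W := Monoid.PushoutI.of (φ := phi AB W) false

theorem oT_AB (z : ℕ × Bool) : oT AB W (AB z) = oF AB W (phiQ W (FreeGroup.of z)) := by
  have h1 := Monoid.PushoutI.of_apply_eq_base (phi AB W) true (FreeGroup.of z)
  have h2 := Monoid.PushoutI.of_apply_eq_base (phi AB W) false (FreeGroup.of z)
  have h3 : AB z = phi AB W true (FreeGroup.of z) := (FreeGroup.lift_apply_of).symm
  rw [h3]
  exact h1.trans h2.symm

def letter (p : Fin 46 × Bool) : Syl :=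
  if p.1.val < 40 then Sum.inl (FreeGroup.mk [p]) else Sum.inr [(Sum.inl p.1, p.2)]

theorem sgv_letter (p : Fin 46 × Bool) : sgv AB (letter p) = FreeGroup.mk [p] := by
  unfold letter
  split_ifs
  · rfl
  · rcases p with ⟨x, s⟩
    simp only [sgv]
    rw [mk_single, mk_single]
    cases s <;> simp [sig]

theorem ssz_letter (wt : ℕ → ℕ) (p : Fin 46 × Bool) : ssz wt (letter p) ≤ 1 := by
  unfold letter
  split_ifs
  · exact FreeGroup.norm_mk_le
  · simp [ssz, esz, ewt]

theorem tau_letter (p : Fin 46 × Bool) :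
    tau W (FreeGroup.mk [(Sum.inl p.1, p.2)]) = SemidirectProduct.inr (FreeGroup.mk [p]) := by
  rcases p with ⟨x, s⟩
  rw [mk_single, mk_single]
  cases s <;> simp [tau]

def hom : FX →* Am AB W := FreeGroup.lift fun x => val AB W (letter (x, true))

theorem val_lt (p : Fin 46 × Bool) (h : p.1.val < 40) :
    val AB W (letter p) = oT AB W (FreeGroup.mk [p]) := by
  unfold letter
  rw [if_pos h]
  rfl

theorem val_ge (p : Fin 46 × Bool) (h : ¬ p.1.val < 40) :
    val AB W (letter p) = oF AB W (SemidirectProduct.inr (FreeGroup.mk [p])) := by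
  unfold letter
  rw [if_neg h, ← tau_letter W]
  rfl

theorem hom_letter (p : Fin 46 × Bool) : hom AB W (FreeGroup.mk [p]) = val AB W (letter p) := by
  rcases p with ⟨x, s⟩
  by_cases h : x.val < 40
  · rw [val_lt AB W _ h, mk_single]
    cases s
    · simp only [cond_false, map_inv, hom, FreeGroup.lift_apply_of]
      rw [val_lt AB W _ h]; rfl
    · simp only [cond_true, hom, FreeGroup.lift_apply_of]
      rw [val_lt AB W _ h]; rfl
  · rw [val_ge AB W _ h, mk_single]
    cases s
    · simp only [cond_false, map_inv, hom, FreeGroup.lift_apply_of]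
      rw [val_ge AB W _ h]; rfl
    · simp only [cond_true, hom, FreeGroup.lift_apply_of]
      rw [val_ge AB W _ h]; rfl

theorem hom_mk (l : List (Fin 46 × Bool)) :
    hom AB W (FreeGroup.mk l) = ((l.map letter).map (val AB W)).prod := by
  induction l with
  | nil => simp [← FreeGroup.one_eq_mk]
  | cons p l ih => rw [mk_cons, map_mul, hom_letter, ih]; simp

theorem sgv_mk (l : List (Fin 46 × Bool)) :
    ((l.map letter).map (sgv AB)).prod = FreeGroup.mk l := by
  induction l with
  | nil => simp [← FreeGroup.one_eq_mk]
  | cons p l ih =>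
    rw [mk_cons, List.map_cons, List.map_cons, List.prod_cons, sgv_letter, ih]

theorem hom_lt (l : List (Fin 46 × Bool)) (h : ∀ p ∈ l, p.1.val < 40) :
    hom AB W (FreeGroup.mk l) = oT AB W (FreeGroup.mk l) := by
  induction l with
  | nil => simp [← FreeGroup.one_eq_mk]
  | cons p l ih =>
    rw [mk_cons, map_mul, map_mul, hom_letter, ih fun q hq => h q (by simp [hq]),
      val_lt AB W p (h p (by simp))]

theorem hom_ge (l : List (Fin 46 × Bool)) (h : ∀ p ∈ l, ¬ p.1.val < 40) :
    hom AB W (FreeGroup.mk l) = oF AB W (SemidirectProduct.inr (FreeGroup.mk l)) := by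
  induction l with
  | nil => simp [← FreeGroup.one_eq_mk]
  | cons p l ih =>
    rw [mk_cons, map_mul, map_mul, map_mul, hom_letter, ih fun q hq => h q (by simp [hq]),
      val_ge AB W p (h p (by simp))]

theorem hom_rel (i : ℕ) (h1 : ∀ b, hom AB W (AB (i, b)) = oT AB W (AB (i, b)))
    (h2 : hom AB W (W i) = oF AB W (SemidirectProduct.inr (W i))) :
    hom AB W (rel AB W i) = 1 := by
  unfold rel
  rw [map_mul, map_mul, map_mul, map_inv, map_inv, h1, h1, h2, oT_AB, oT_AB]
  have e1 : phiQ W (FreeGroup.of (i, false)) = SemidirectProduct.inl (FreeGroup.of (1, i)) := by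
    simp [phiQ, key1, key]
  have e2 : phiQ W (FreeGroup.of (i, true)) =
      SemidirectProduct.inl (FreeGroup.of ((W i)⁻¹, i)) := by
    simp [phiQ, key1, key]
  have e3 : (SemidirectProduct.inl (FreeGroup.of ((W i)⁻¹, i)) : QG) =
      SemidirectProduct.inr (W i)⁻¹ * SemidirectProduct.inl (FreeGroup.of (1, i)) *
        SemidirectProduct.inr (W i) := by
    have := SemidirectProduct.inl_aut (φ := act) ((W i)⁻¹) (FreeGroup.of (1, i))
    rw [act_of, mul_one, inv_inv] at this
    exact this
  rw [e1, e2, e3]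
  simp only [map_mul, map_inv]
  group

end

theorem hom_relator (f t : ℕ → ℕ) (i : ℕ) :
    hom (ABf f) (Wf t) (rel (ABf f) (Wf t) i) = 1 := by
  apply hom_rel
  · intro b
    apply hom_lt
    intro p hp
    cases b <;>
    · simp only [cond_true, cond_false, aWord, bWord, List.mem_flatten, List.mem_ofFn] at hp
      obtain ⟨_, ⟨k, rfl⟩, hp⟩ := hp
      have := List.eq_of_mem_replicate hp
      subst this
      simp [genA, genB]
      omega
  · apply hom_ge
    intro p hp
    simp only [conjWord, List.mem_append] at hp
    rcases hp with ((((hp | hp) | hp) | hp) | hp) | hp <;>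
    · have := List.eq_of_mem_replicate hp
      subst this
      simp [genC, genD]

/-- the bound -/
def bnd (n : ℕ) : ℕ := n + (fun L => 2 * (40 * L * L + L))^[n] 1

theorem relator_mem (f t : ℕ → ℕ) (i : ℕ) :
    rel (ABf f) (Wf t) i ∈ Subgroup.normalClosure (relatorSet f t) :=
  Subgroup.subset_normalClosure ⟨i + 1, by omega, rel_eq f t i⟩

theorem NC_mem (f t : ℕ → ℕ) (M n : ℕ) (x : FX) (h : NC (rel (ABf f) (Wf t)) M n x) :
    x ∈ Subgroup.normalClosure (relatorSet f t) := by
  induction h with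
  | one => exact one_mem _
  | skip n x _ ih => exact ih
  | mul n x u i s _ _ _ ih =>
    refine mul_mem (Subgroup.Normal.conj_mem inferInstance _ ?_ u) ih
    cases s
    · exact inv_mem (relator_mem f t i)
    · exact relator_mem f t i

theorem mkG_iff (f t : ℕ → ℕ) (hf : Function.Injective f)
    (hf1 : ∀ i : ℕ, 1 ≤ i → 1 ≤ f i) (w : List (Fin 46 × Bool)) :
    mkG f t w = 1 ↔ NC (rel (ABf f) (Wf t))
      (3 * bnd w.length + 3 * bnd w.length * bnd w.length) (w.length * bnd w.length)
      (FreeGroup.mk w) := by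
  unfold mkG
  rw [QuotientGroup.eq_one_iff]
  constructor
  · intro h
    have h1 : hom (ABf f) (Wf t) (FreeGroup.mk w) = 1 := by
      have : Subgroup.normalClosure (relatorSet f t) ≤ (hom (ABf f) (Wf t)).ker := by
        apply Subgroup.normalClosure_le_normal
        rintro _ ⟨i, hi, rfl⟩
        obtain ⟨i, rfl⟩ : ∃ k, i = k + 1 := ⟨i - 1, by omega⟩
        rw [SetLike.mem_coe, MonoidHom.mem_ker, ← rel_eq]
        exact hom_relator f t i
      exact this h
    rw [hom_mk] at h1
    have := main_bound (ABf f) (Wf t) (fun i => 20 * f (i + 1))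
      (fun i => by have := hf1 (i + 1) (by omega); omega) (norm_ABf f) (norm_Wf t)
      (fun L => 40 * L * L) (fun a b hab => by show 40 * a * a ≤ 40 * b * b; gcongr) (psz_bound f hf hf1)
      (lift_ABf_injective f hf hf1) (bnd w.length) w.length 1 (w.map letter) (by simp)
      (Nat.le_add_right _ _) (by
        intro x hx
        obtain ⟨p, _, rfl⟩ := List.mem_map.1 hx
        exact ssz_letter _ p) (Nat.le_add_left _ _) h1
    rwa [sgv_mk] at this
  · exact NC_mem f t _ _ _

end WP
namespace WP

abbrev WD := List (Fin 46 × Bool)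

def letters : List (Fin 46 × Bool) :=
  (List.finRange 46).flatMap fun x => [(x, true), (x, false)]

theorem mem_letters (p : Fin 46 × Bool) : p ∈ letters := by
  rcases p with ⟨x, _ | _⟩ <;> simp [letters]

def wordsLE (n : ℕ) : List WD :=
  n.rec (motive := fun _ => List WD) [[]]
    fun _ ih => [] :: ih.flatMap fun w => letters.map fun p => p :: w

theorem mem_wordsLE (n : ℕ) (w : WD) : w ∈ wordsLE n ↔ w.length ≤ n := by
  induction n generalizing w with
  | zero => simp [wordsLE]
  | succ n ih =>
    have e : wordsLE (n + 1) =
      [] :: (wordsLE n).flatMap fun w => letters.map fun p => p :: w := rfl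
    rw [e]
    cases w with
    | nil => simp
    | cons p w =>
      simp only [List.mem_cons, List.mem_flatMap, List.mem_map, List.length_cons]
      constructor
      · rintro (h | ⟨u, hu, q, hq, h⟩)
        · simp at h
        · rw [ih] at hu
          simp only [List.cons.injEq] at h
          rw [← h.2]; omega
      · intro h
        exact Or.inr ⟨w, (ih w).2 (by omega), p, mem_letters p, rfl⟩

theorem primrec_wordsLE : Primrec wordsLE := by
  unfold wordsLE
  refine Primrec.nat_rec' Primrec.id (Primrec.const [[]])
    (h := fun _ (q : ℕ × List WD) => [] :: q.2.flatMap fun w => letters.map fun p => p :: w) ?_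
  refine Primrec.list_cons.comp (Primrec.const []) ?_
  refine Primrec.list_flatMap (Primrec.snd.comp Primrec.snd) ?_
  refine Primrec.list_map (Primrec.const letters) ?_
  exact Primrec.list_cons.comp Primrec.snd (Primrec.snd.comp Primrec.fst)

def cj (u r : WD) : WD := u ++ (r ++ FreeGroup.invRev u)

def conjs (us rs : List WD) : List WD :=
  us.flatMap fun u => rs.flatMap fun r => [cj u r, cj u (FreeGroup.invRev r)]

theorem primrec_invRev : Primrec (FreeGroup.invRev : WD → WD) := by
  unfold FreeGroup.invRev
  refine Primrec.list_reverse.comp (Primrec.list_map Primrec.id ?_)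
  exact Primrec.pair (Primrec.fst.comp Primrec.snd)
    (Primrec.not.comp (Primrec.snd.comp Primrec.snd))

theorem primrec_cj : Primrec₂ cj :=
  Primrec.list_append.comp Primrec.fst
    (Primrec.list_append.comp Primrec.snd (primrec_invRev.comp Primrec.fst))

theorem primrec_conjs : Primrec₂ conjs := by
  refine Primrec.list_flatMap Primrec.fst ?_
  refine Primrec.list_flatMap (Primrec.snd.comp Primrec.fst) ?_
  have hu : Primrec fun x : ((List WD × List WD) × WD) × WD => x.1.2 :=
    Primrec.snd.comp Primrec.fst
  have hr : Primrec fun x : ((List WD × List WD) × WD) × WD => x.2 := Primrec.snd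
  exact Primrec.list_cons.comp (primrec_cj.comp hu hr)
    (Primrec.list_cons.comp (primrec_cj.comp hu (primrec_invRev.comp hr)) (Primrec.const []))

def prods (cs : List WD) (n : ℕ) : List WD :=
  n.rec (motive := fun _ => List WD) [[]]
    fun _ ih => ih ++ cs.flatMap fun c => ih.map fun x => c ++ x

theorem primrec_prods : Primrec₂ prods := by
  unfold prods
  refine Primrec.nat_rec (Primrec.const [[]])
    (g := fun (cs : List WD) (q : ℕ × List WD) => q.2 ++ cs.flatMap fun c => q.2.map fun x => c ++ x) ?_
  refine Primrec.list_append.comp (Primrec.snd.comp Primrec.snd) ?_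
  refine Primrec.list_flatMap Primrec.fst ?_
  refine Primrec.list_map (Primrec.snd.comp (Primrec.snd.comp Primrec.fst)) ?_
  exact Primrec.list_append.comp (Primrec.snd.comp Primrec.fst) Primrec.snd

theorem primrec_reduce : Primrec (FreeGroup.reduce : WD → WD) := by
  have hcase : Primrec₂ fun (_ : WD) (q : (Fin 46 × Bool) × WD × WD) =>
      (List.casesOn (motive := fun _ => WD) q.2.2 [q.1] fun hd tl =>
        if q.1.1 = hd.1 ∧ q.1.2 = not hd.2 then tl else q.1 :: hd :: tl : WD) := by
    have hq : Primrec fun x : WD × ((Fin 46 × Bool) × WD × WD) => x.2.1 :=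
      Primrec.fst.comp Primrec.snd
    refine Primrec.list_casesOn
      (f := fun x : WD × ((Fin 46 × Bool) × WD × WD) => x.2.2.2)
      (g := fun x => [x.2.1])
      (h := fun x y => if x.2.1.1 = y.1.1 ∧ x.2.1.2 = not y.1.2 then y.2
        else x.2.1 :: y.1 :: y.2) ?_ ?_ ?_
    · exact Primrec.snd.comp (Primrec.snd.comp Primrec.snd)
    · exact Primrec.list_cons.comp hq (Primrec.const [])
    · have hq' : Primrec fun z : (WD × ((Fin 46 × Bool) × WD × WD)) × ((Fin 46 × Bool) × WD) =>
          z.1.2.1 := hq.comp Primrec.fst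
      have hy : Primrec fun z : (WD × ((Fin 46 × Bool) × WD × WD)) × ((Fin 46 × Bool) × WD) =>
          z.2.1 := Primrec.fst.comp Primrec.snd
      have ht : Primrec fun z : (WD × ((Fin 46 × Bool) × WD × WD)) × ((Fin 46 × Bool) × WD) =>
          z.2.2 := Primrec.snd.comp Primrec.snd
      refine Primrec.ite (PrimrecPred.and ?_ ?_) ht
        (Primrec.list_cons.comp hq' (Primrec.list_cons.comp hy ht))
      · exact Primrec.eq.comp (Primrec.fst.comp hq') (Primrec.fst.comp hy)
      · exact Primrec.eq.comp (Primrec.snd.comp hq') (Primrec.not.comp (Primrec.snd.comp hy))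
  exact Primrec.list_rec Primrec.id (Primrec.const []) hcase

def table (f t : ℕ → ℕ) (n : ℕ) : List WD :=
  n.rec (motive := fun _ => List WD) [] fun k ih => relatorWord f t (k + 1) :: ih

theorem mem_table (f t : ℕ → ℕ) (n : ℕ) (r : WD) :
    r ∈ table f t n ↔ ∃ i, i + 1 ≤ n ∧ r = relatorWord f t (i + 1) := by
  induction n with
  | zero => simp [table]
  | succ n ih =>
    have e : table f t (n + 1) = relatorWord f t (n + 1) :: table f t n := rfl
    rw [e, List.mem_cons, ih]
    constructor
    · rintro (h | ⟨i, h1, h2⟩)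
      · exact ⟨n, le_rfl, h⟩
      · exact ⟨i, by omega, h2⟩
    · rintro ⟨i, h1, h2⟩
      by_cases h : i = n
      · subst h; exact Or.inl h2
      · exact Or.inr ⟨i, by omega, h2⟩

theorem primrec_genPow (x : Fin 46) (s : Bool) : Primrec (genPow x s) := by
  refine (Primrec.list_map Primrec.list_range (Primrec₂.const (x, s))).of_eq ?_
  intro n
  simp [genPow, List.map_const']

theorem primrec_aWord : Primrec aWord :=
  Primrec.list_flatten.comp (Primrec.list_ofFn fun k => primrec_genPow (genA k) true)

theorem primrec_bWordRevInv : Primrec bWordRevInv :=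
  Primrec.list_flatten.comp (Primrec.list_ofFn fun k => primrec_genPow (genB k.rev) false)

theorem primrec_conjWord : Primrec₂ conjWord := by
  have hc (k : Fin 3) (s : Bool) : Primrec fun z : ℕ × ℕ => genPow (genC k) s z.1 :=
    (primrec_genPow _ _).comp Primrec.fst
  have hd (k : Fin 3) (s : Bool) : Primrec fun z : ℕ × ℕ => genPow (genD k) s z.2 :=
    (primrec_genPow _ _).comp Primrec.snd
  have ha {g h : ℕ × ℕ → WD} (hg : Primrec g) (hh : Primrec h) :
    Primrec fun z => g z ++ h z := Primrec.list_append.comp hg hh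
  exact ha (ha (ha (ha (ha (hc 0 _) (hd 0 _)) (hc 1 _)) (hd 1 _)) (hc 2 _)) (hd 2 _)

theorem primrec_conjWordInv : Primrec₂ conjWordInv := by
  have hc (k : Fin 3) (s : Bool) : Primrec fun z : ℕ × ℕ => genPow (genC k) s z.1 :=
    (primrec_genPow _ _).comp Primrec.fst
  have hd (k : Fin 3) (s : Bool) : Primrec fun z : ℕ × ℕ => genPow (genD k) s z.2 :=
    (primrec_genPow _ _).comp Primrec.snd
  have ha {g h : ℕ × ℕ → WD} (hg : Primrec g) (hh : Primrec h) :
    Primrec fun z => g z ++ h z := Primrec.list_append.comp hg hh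
  exact ha (ha (ha (ha (ha (hd 2 _) (hc 2 _)) (hd 1 _)) (hc 1 _)) (hd 0 _)) (hc 0 _)

theorem computable_relatorWord (f t : ℕ → ℕ) (hfc : Computable f) (htc : Computable t) :
    Computable (relatorWord f t) := by
  have ha {g h : ℕ → WD} (hg : Computable g) (hh : Computable h) :
    Computable fun z => g z ++ h z := Computable.list_append.comp hg hh
  exact ha (ha (ha (primrec_aWord.to_comp.comp hfc)
    (primrec_conjWord.to_comp.comp Computable.id htc))
    (primrec_bWordRevInv.to_comp.comp hfc))
    (primrec_conjWordInv.to_comp.comp Computable.id htc)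

theorem computable_table (f t : ℕ → ℕ) (hfc : Computable f) (htc : Computable t) :
    Computable (table f t) := by
  unfold table
  refine Computable.nat_rec Computable.id (Computable.const [])
    (h := fun _ (q : ℕ × List WD) => relatorWord f t (q.1 + 1) :: q.2) ?_
  exact Computable.list_cons.comp
    ((computable_relatorWord f t hfc htc).comp
      (Computable.succ.comp (Computable.fst.comp Computable.snd)))
    (Computable.snd.comp Computable.snd)

theorem primrec_bnd : Primrec bnd := by
  refine Primrec.nat_add.comp Primrec.id ?_
  refine Primrec.nat_iterate Primrec.id (Primrec.const 1)
    (h := fun _ L => 2 * (40 * L * L + L)) ?_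
  have hL : Primrec fun z : ℕ × ℕ => z.2 := Primrec.snd
  exact Primrec.nat_mul.comp (Primrec.const 2) (Primrec.nat_add.comp
    (Primrec.nat_mul.comp (Primrec.nat_mul.comp (Primrec.const 40) hL) hL) hL)

def bndM (n : ℕ) : ℕ := 3 * bnd n + 3 * bnd n * bnd n

theorem primrec_bndM : Primrec bndM :=
  Primrec.nat_add.comp (Primrec.nat_mul.comp (Primrec.const 3) primrec_bnd)
    (Primrec.nat_mul.comp (Primrec.nat_mul.comp (Primrec.const 3) primrec_bnd) primrec_bnd)

theorem mk_cj (u r : WD) :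
    FreeGroup.mk (cj u r) = FreeGroup.mk u * FreeGroup.mk r * (FreeGroup.mk u)⁻¹ := by
  unfold cj
  rw [← FreeGroup.mul_mk, ← FreeGroup.mul_mk, FreeGroup.inv_mk, mul_assoc]

theorem NC_iff (f t : ℕ → ℕ) (M n : ℕ) (x : FX) :
    NC (rel (ABf f) (Wf t)) M n x ↔
      ∃ l ∈ prods (conjs (wordsLE M) (table f t M)) n, FreeGroup.mk l = x := by
  set cs := conjs (wordsLE M) (table f t M) with hcs
  have e : ∀ n, prods cs (n + 1) =
    prods cs n ++ cs.flatMap fun c => (prods cs n).map fun x => c ++ x := fun _ => rfl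
  constructor
  · intro h
    induction h with
    | one => exact ⟨[], by simp [prods], rfl⟩
    | skip n x _ ih =>
      obtain ⟨l, h1, h2⟩ := ih
      exact ⟨l, by rw [e]; exact List.mem_append_left _ h1, h2⟩
    | mul n x u i s _ hu hi ih =>
      obtain ⟨l, h1, h2⟩ := ih
      refine ⟨cj u.toWord (cond s (relatorWord f t (i + 1))
        (FreeGroup.invRev (relatorWord f t (i + 1)))) ++ l, ?_, ?_⟩
      · rw [e]
        refine List.mem_append_right _ (List.mem_flatMap.2 ⟨_, ?_, List.mem_map.2 ⟨l, h1, rfl⟩⟩)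
        refine List.mem_flatMap.2 ⟨u.toWord, (mem_wordsLE _ _).2 hu, List.mem_flatMap.2
          ⟨_, (mem_table _ _ _ _).2 ⟨i, hi, rfl⟩, ?_⟩⟩
        cases s <;> simp
      · rw [← FreeGroup.mul_mk, mk_cj, FreeGroup.mk_toWord, h2]
        cases s
        · simp only [cond_false]; rw [← FreeGroup.inv_mk, rel_eq]
        · simp only [cond_true]; rw [rel_eq]
  · rintro ⟨l, hl, rfl⟩
    induction n generalizing l with
    | zero =>
      have : l = [] := by simpa [prods] using hl
      subst this
      exact NC.one
    | succ n ih =>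
      rw [e, List.mem_append] at hl
      rcases hl with hl | hl
      · exact NC.skip _ _ (ih l hl)
      · obtain ⟨c, hc, hl⟩ := List.mem_flatMap.1 hl
        obtain ⟨l, hl', rfl⟩ := List.mem_map.1 hl
        obtain ⟨u, hu, hc⟩ := List.mem_flatMap.1 hc
        obtain ⟨r, hr, hc⟩ := List.mem_flatMap.1 hc
        rw [mem_wordsLE] at hu
        obtain ⟨i, hi, rfl⟩ := (mem_table _ _ _ _).1 hr
        have hn : (FreeGroup.mk u).norm ≤ M := FreeGroup.norm_mk_le.trans hu
        simp only [List.mem_cons, List.not_mem_nil, or_false] at hc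
        rcases hc with rfl | rfl
        · have := NC.mul _ _ (FreeGroup.mk u) i true (ih l hl') hn hi
          rw [← FreeGroup.mul_mk, mk_cj, ← rel_eq]
          exact this
        · have := NC.mul _ _ (FreeGroup.mk u) i false (ih l hl') hn hi
          rw [← FreeGroup.mul_mk, mk_cj, ← FreeGroup.inv_mk, ← rel_eq]
          exact this

/-- the search predicate -/
def Search (z : WD × List WD) : Prop :=
  ∃ x ∈ prods (conjs (wordsLE (bndM z.1.length)) z.2) (z.1.length * bnd z.1.length),
    FreeGroup.reduce x = FreeGroup.reduce z.1

theorem primrec_search : PrimrecPred Search := by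
  have hR : PrimrecRel fun x w : WD => FreeGroup.reduce x = FreeGroup.reduce w :=
    Primrec.eq.comp (primrec_reduce.comp Primrec.fst) (primrec_reduce.comp Primrec.snd)
  have hlen : Primrec fun z : WD × List WD => z.1.length :=
    Primrec.list_length.comp Primrec.fst
  refine hR.exists_mem_list.comp (primrec_prods.comp (primrec_conjs.comp
    (primrec_wordsLE.comp (primrec_bndM.comp hlen)) Primrec.snd)
    (Primrec.nat_mul.comp hlen (primrec_bnd.comp hlen))) Primrec.fst

theorem mkG_iff_search (f t : ℕ → ℕ) (hf : Function.Injective f)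
    (hf1 : ∀ i : ℕ, 1 ≤ i → 1 ≤ f i) (w : WD) :
    Search (w, table f t (bndM w.length)) ↔ mkG f t w = 1 := by
  rw [mkG_iff f t hf hf1, NC_iff]
  unfold Search
  simp only [← FreeGroup.toWord_mk, FreeGroup.toWord_inj]
  rfl

end WP

/-- If `f` and `t` are computable, the word problem of `G` is decidable. -/
theorem word_problem_decidable (f t : ℕ → ℕ) (hf : Function.Injective f)
    (hf1 : ∀ i : ℕ, 1 ≤ i → 1 ≤ f i) (ht1 : ∀ i : ℕ, 1 ≤ i → 1 ≤ t i)
    (hfc : Computable f) (htc : Computable t) :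
    ComputablePred fun w : Word (Fin 46) => mkG f t w = 1 := by
  obtain ⟨inst, h⟩ := WP.primrec_search
  have hc : ComputablePred fun w : Word (Fin 46) =>
      WP.Search (w, WP.table f t (WP.bndM w.length)) :=
    ⟨fun w => inst (w, WP.table f t (WP.bndM w.length)), h.to_comp.comp
      (Computable.pair Computable.id ((WP.computable_table f t hfc htc).comp
        (WP.primrec_bndM.to_comp.comp Computable.list_length)))⟩
  exact hc.of_eq fun w => WP.mkG_iff_search f t hf hf1 w
end
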